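/- arXiv:1903.01053 — 4 statements merged into one kernel-verified Lean document; each statement's English description precedes it below -/
import Mathlib

section
/- Let A : ℝ^{n₁×n₂} → ℝ^m be a linear map satisfying the RIP of order ⌈tk⌉ with restricted isometry constant δ_{tk} satisfying δ_{tk} < √((t−1)/t) for some fixed t > 1 and positive integer k. Let X ∈ ℝ^{n₁×n₂}, let n ∈ ℝ^m with ‖n‖₂ ≤ ε, let b = A(X) + n, let λ > 0, and let X♯ be any minimizer of the regularized nuclear norm problem min_Z ‖Z‖_* + (1/(2λ))‖b − A(Z)‖₂². Then ‖A(X♯ − X)‖₂ ≤ C₁‖X − X_{[k]}‖_* + C₂, where C₁ = 2λ/(√k·β₁·λ + ε) and C₂ = 2√k·β₁·λ + 2ε, with β₁ = 2/((1−δ_{tk})√(1+δ_{tk})). -/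
open Finset

/-- Frobenius norm of a real matrix. -/
noncomputable def frobNorm {n₁ n₂ : ℕ} (M : Matrix (Fin n₁) (Fin n₂) ℝ) : ℝ :=
  Real.sqrt (∑ i, ∑ j, M i j ^ 2)

/-- Nuclear norm of a real matrix: sum of its singular values, i.e. of the
square roots of the eigenvalues of `M * Mᵀ`. -/
noncomputable def nucNorm {n₁ n₂ : ℕ} (M : Matrix (Fin n₁) (Fin n₂) ℝ) : ℝ :=
  ∑ i, Real.sqrt ((Matrix.isHermitian_mul_conjTranspose_self M).eigenvalues i)

/-- `A` satisfies the RIP of order `r` with constant `δ`. -/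
def HasRIP {n₁ n₂ m : ℕ} (A : Matrix (Fin n₁) (Fin n₂) ℝ →ₗ[ℝ] EuclideanSpace ℝ (Fin m))
    (r : ℕ) (δ : ℝ) : Prop :=
  ∀ M : Matrix (Fin n₁) (Fin n₂) ℝ, M.rank ≤ r →
    (1 - δ) * frobNorm M ^ 2 ≤ ‖A M‖ ^ 2 ∧ ‖A M‖ ^ 2 ≤ (1 + δ) * frobNorm M ^ 2

/-- The rank-one matrix `s • u vᵀ`. -/
noncomputable def rank1 {n₁ n₂ : ℕ} (s : ℝ) (u : Fin n₁ → ℝ) (v : Fin n₂ → ℝ) :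
    Matrix (Fin n₁) (Fin n₂) ℝ :=
  Matrix.of fun a b => s * u a * v b

/-- Among the subsets of `s` with at most `q` elements, one does at least as well as the
weights `w` bounded by `τ` with total at most `q * τ`. -/
lemma exists_subset_card_le_sum_le {ι : Type*} (s : Finset ι) (c w : ι → ℝ) {τ : ℝ} (q : ℕ)
    (hw0 : ∀ i ∈ s, 0 ≤ w i) (hw1 : ∀ i ∈ s, w i ≤ τ)
    (hw : ∑ i ∈ s, w i ≤ q * τ) :
    ∃ T ⊆ s, T.card ≤ q ∧ τ * ∑ i ∈ T, c i ≤ ∑ i ∈ s, c i * w i := by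
  classical
  obtain ⟨T, hT, hmin⟩ := (s.powerset.filter fun T => T.card ≤ q).exists_min_image
    (fun T => ∑ i ∈ T, c i) ⟨∅, by simp⟩
  simp only [mem_filter, mem_powerset] at hT hmin
  obtain ⟨hTs, hTq⟩ := hT
  refine ⟨T, hTs, hTq, ?_⟩
  obtain ⟨θ, hθ, hin, hout⟩ : ∃ θ : ℝ, (θ * (∑ i ∈ s, w i - T.card * τ) ≥ 0) ∧
      (∀ i ∈ T, c i ≤ θ) ∧ ∀ i ∈ s \ T, θ ≤ c i := by
    have hneg : ∀ i ∈ T, c i ≤ 0 := fun i hi => by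
      have := hmin (T.erase i) ⟨(erase_subset i T).trans hTs, (card_erase_le).trans hTq⟩
      rw [← add_sum_erase T c hi] at this
      linarith
    rcases hTq.lt_or_eq with hlt | heq
    · refine ⟨0, by simp, hneg, fun j hj => ?_⟩
      rw [mem_sdiff] at hj
      have := hmin (insert j T) ⟨insert_subset hj.1 hTs, (card_insert_le j T).trans hlt⟩
      rw [sum_insert hj.2] at this
      linarith
    · rcases T.eq_empty_or_nonempty with rfl | hne
      · have h0 : ∑ i ∈ s, w i = 0 := le_antisymm (by simpa [← heq] using hw) (sum_nonneg hw0)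
        refine ⟨-∑ i ∈ s, |c i|, by simp [h0], by simp, fun j hj => ?_⟩
        have hle : |c j| ≤ ∑ i ∈ s, |c i| :=
          single_le_sum (f := fun i => |c i|) (fun i _ => abs_nonneg (c i)) (mem_sdiff.1 hj).1
        linarith [neg_abs_le (c j)]
      · obtain ⟨i, hi, hmax⟩ := T.exists_max_image c hne
        refine ⟨c i, ?_, hmax, fun j hj => ?_⟩
        · rw [heq]
          exact mul_nonneg_of_nonpos_of_nonpos (hneg i hi) (by linarith)
        · rw [mem_sdiff] at hj
          have hj' : j ∉ T.erase i := fun h => hj.2 (mem_of_mem_erase h)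
          have := hmin (insert j (T.erase i))
            ⟨insert_subset hj.1 ((erase_subset i T).trans hTs), by
              rw [card_insert_of_notMem hj', card_erase_add_one hi]; exact hTq⟩
          rw [sum_insert hj', ← add_sum_erase T c hi] at this
          linarith
  have h1 : ∑ i ∈ s \ T, θ * w i ≤ ∑ i ∈ s \ T, c i * w i := sum_le_sum fun i hi =>
    mul_le_mul_of_nonneg_right (hout i hi) (hw0 i (mem_sdiff.1 hi).1)
  have h2 : ∑ i ∈ T, c i * (τ - w i) ≤ ∑ i ∈ T, θ * (τ - w i) := sum_le_sum fun i hi =>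
    mul_le_mul_of_nonneg_right (hin i hi) (sub_nonneg.2 (hw1 i (hTs hi)))
  have h3 := sum_sdiff (f := fun i => c i * w i) hTs
  have h4 := sum_sdiff (f := w) hTs
  simp only [mul_sub, sum_sub_distrib, ← mul_sum, ← sum_mul, sum_const, nsmul_eq_mul] at h1 h2
  rw [← h4] at hθ
  rw [← h3]
  linarith

/-- The last step of the null space property: solving the quadratic inequality that the
restricted isometry property yields for `x`. -/
lemma sub_le_of_quadratic_le {δ x N U K e s : ℝ} (hδ0 : 0 < δ) (hδ1 : δ < 1) (hK : 0 < K)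
    (hN0 : 0 ≤ N) (he : 0 ≤ e) (hsx : s ≤ K * x)
    (hU : δ ^ 2 * U * K ^ 2 ≤ (1 - δ ^ 2) * N ^ 2)
    (hmain : (1 - δ ^ 2) * x ^ 2 - δ ^ 2 * U ≤ 2 * (Real.sqrt (1 + δ) * x * e)) :
    s - N ≤ K * (2 / ((1 - δ) * Real.sqrt (1 + δ))) * e := by
  have hRsq : Real.sqrt (1 + δ) ^ 2 = 1 + δ := Real.sq_sqrt (by linarith)
  have hR0 : 0 < Real.sqrt (1 + δ) := Real.sqrt_pos.2 (by linarith)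
  generalize Real.sqrt (1 + δ) = R at *
  have hδ2 : 0 < 1 - δ ^ 2 := by nlinarith
  have hrhs : K * (2 / ((1 - δ) * R)) * e = 2 * R * K * e / (1 - δ ^ 2) := by
    have : 1 - δ ≠ 0 := by linarith
    have : 1 - δ ^ 2 = (1 - δ) * R ^ 2 := by rw [hRsq]; ring
    rw [this]
    field_simp
  rw [hrhs, le_div_iff₀ hδ2]
  rcases le_or_gt (K * x) N with hle | hgt
  · have : s - N ≤ 0 := by linarith
    exact (mul_nonpos_of_nonpos_of_nonneg this hδ2.le).trans (by positivity)
  · have hx_pos : 0 < K * x := lt_of_le_of_lt hN0 hgt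
    have h1 : (1 - δ ^ 2) * ((K * x) ^ 2 - N ^ 2) ≤ 2 * R * K * e * (K * x) := by
      have := mul_le_mul_of_nonneg_right hmain (sq_nonneg K)
      linarith
    have h2 : (K * x - N) * (1 - δ ^ 2) * (K * x) ≤ (1 - δ ^ 2) * ((K * x) ^ 2 - N ^ 2) := by
      linarith [mul_nonneg hδ2.le (mul_nonneg hN0 (sub_nonneg.2 hgt.le))]
    have h3 := le_of_mul_le_mul_right (h2.trans h1) hx_pos
    exact (mul_le_mul_of_nonneg_right (sub_le_sub_right hsx N) hδ2.le).trans h3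

/-- A combination of two values of a quadratic form that is bounded below by the restricted
isometry property. -/
lemma rip_combination_le {F : Type*} [NormedAddCommGroup F] [InnerProductSpace ℝ F] {p q : F}
    {δ x2 U : ℝ} (hδ0 : 0 < δ)
    (hrip : ∀ α γ : ℝ, (1 - δ) * (α ^ 2 * x2 + γ ^ 2 * U) ≤ ‖α • p + γ • q‖ ^ 2 ∧
      ‖α • p + γ • q‖ ^ 2 ≤ (1 + δ) * (α ^ 2 * x2 + γ ^ 2 * U)) :
    (1 - δ ^ 2) * x2 - δ ^ 2 * U ≤ 2 * (‖p‖ ^ 2 + inner ℝ p q) := by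
  have h1 := (hrip (1 + δ) δ).1
  have h2 := (hrip (1 - δ) (-δ)).2
  have hpol : ‖(1 + δ) • p + δ • q‖ ^ 2 - ‖(1 - δ) • p + (-δ) • q‖ ^ 2 =
      4 * δ * (‖p‖ ^ 2 + inner ℝ p q) := by
    rw [norm_add_sq_real, norm_add_sq_real]
    simp only [norm_smul, inner_smul_left, inner_smul_right, mul_pow, Real.norm_eq_abs, sq_abs,
      conj_trivial]
    ring
  have h3 : 2 * δ * ((1 - δ ^ 2) * x2 - δ ^ 2 * U) ≤
      2 * δ * (2 * (‖p‖ ^ 2 + inner ℝ p q)) := by linarith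
  exact le_of_mul_le_mul_left h3 (by positivity)

/-- A null space property from the restricted isometry property, for vectors. -/
lemma sum_sub_sum_compl_le_of_rip {ι F : Type*} [Fintype ι] [DecidableEq ι]
    [NormedAddCommGroup F] [InnerProductSpace ℝ F] (B : (ι → ℝ) →ₗ[ℝ] F) {δ : ℝ} {k r : ℕ}
    (hk : 0 < k) (hr : 0 < r) (hδ0 : 0 < δ) (hδ1 : δ < 1)
    (hδ : δ ^ 2 * k ≤ (1 - δ ^ 2) * r)
    (hB : ∀ c : ι → ℝ, (univ.filter fun i => c i ≠ 0).card ≤ k + r →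
      (1 - δ) * ∑ i, c i ^ 2 ≤ ‖B c‖ ^ 2 ∧ ‖B c‖ ^ 2 ≤ (1 + δ) * ∑ i, c i ^ 2)
    (s : ι → ℝ) (hs : ∀ i, 0 ≤ s i) (S : Finset ι) (hS : S.card ≤ k) :
    ∑ i ∈ S, s i - ∑ i ∈ Sᶜ, s i ≤
      Real.sqrt k * (2 / ((1 - δ) * Real.sqrt (1 + δ))) * ‖B s‖ := by
  set N := ∑ i ∈ Sᶜ, s i with hN
  have hN0 : 0 ≤ N := sum_nonneg fun i _ => hs i
  have hr' : (0 : ℝ) < r := by exact_mod_cast hr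
  have hk' : (0 : ℝ) < k := by exact_mod_cast hk
  set τ := N / r with hτ
  have hτ0 : 0 ≤ τ := by positivity
  have hrτ : r * τ = N := by rw [hτ]; field_simp
  set S₁ := Sᶜ.filter fun i => τ < s i with hS₁
  set D := S ∪ S₁ with hD
  have hS₁sub : S₁ ⊆ Sᶜ := filter_subset _ _
  have hdisj : Disjoint S S₁ := disjoint_of_subset_right hS₁sub disjoint_compl_right
  have hS₁sum : S₁.card * τ ≤ ∑ i ∈ S₁, s i := by
    rw [← nsmul_eq_mul]
    exact card_nsmul_le_sum _ _ _ fun i hi => (mem_filter.1 hi).2.le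
  have hDsum : ∑ i ∈ S₁, s i + ∑ i ∈ Dᶜ, s i = N := by
    have h1 := sum_add_sum_compl D s
    have h2 := sum_add_sum_compl S s
    rw [hD, sum_union hdisj] at h1
    linarith
  have hDc0 : 0 ≤ ∑ i ∈ Dᶜ, s i := sum_nonneg fun i _ => hs i
  have hcard : S₁.card ≤ r := by
    rcases hτ0.eq_or_lt with h0 | hpos
    · have hN' : N = 0 := by rw [← hrτ, ← h0, mul_zero]
      have : S₁ = ∅ := by
        refine filter_eq_empty_iff.2 fun i hi => not_lt.2 ?_
        rw [← h0]
        exact ((sum_eq_zero_iff_of_nonneg fun i _ => hs i).1 hN' i hi).le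
      simp [this]
    · have : (S₁.card : ℝ) * τ ≤ r * τ := by linarith
      exact_mod_cast le_of_mul_le_mul_right this hpos
  set a : ι → ℝ := fun i => if i ∈ D then s i else 0 with ha
  obtain ⟨T, hTD, hTcard, hT⟩ := exists_subset_card_le_sum_le Dᶜ
    (fun i => inner ℝ (B a) (B (Pi.single i 1))) s (τ := τ) (r - S₁.card)
    (fun i _ => hs i)
    (fun i hi => by
      simp only [hD, hS₁, mem_compl, mem_union, mem_filter, not_or, not_and, not_lt] at hi
      exact hi.2 hi.1)
    (by push_cast [hcard]; nlinarith)
  set y : ι → ℝ := fun i => if i ∈ T then τ else 0 with hy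
  have hBy : inner ℝ (B a) (B y) =
      τ * ∑ i ∈ T, inner ℝ (B a) (B (Pi.single i 1)) := by
    have : y = ∑ i ∈ T, τ • (Pi.single i 1 : ι → ℝ) := by
      ext j
      simp [hy, Finset.sum_apply, Pi.single_apply]
    rw [this, map_sum, inner_sum, mul_sum]
    simp [inner_smul_right]
  have hBs : inner ℝ (B a) (B s) = ‖B a‖ ^ 2 +
      ∑ i ∈ Dᶜ, inner ℝ (B a) (B (Pi.single i 1)) * s i := by
    have : s = a + ∑ i ∈ Dᶜ, s i • (Pi.single i 1 : ι → ℝ) := by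
      ext j
      by_cases hj : j ∈ D <;> simp [ha, hj, Finset.sum_apply, Pi.single_apply]
    conv_lhs => rw [this]
    rw [map_add, inner_add_right, real_inner_self_eq_norm_sq, map_sum, inner_sum]
    simp [inner_smul_right, mul_comm]
  set x2 := ∑ i, a i ^ 2 with hx2
  have hx20 : 0 ≤ x2 := sum_nonneg fun i _ => sq_nonneg _
  have hrip : ∀ α γ : ℝ, (1 - δ) * (α ^ 2 * x2 + γ ^ 2 * (T.card * τ ^ 2)) ≤
      ‖α • B a + γ • B y‖ ^ 2 ∧
      ‖α • B a + γ • B y‖ ^ 2 ≤ (1 + δ) * (α ^ 2 * x2 + γ ^ 2 * (T.card * τ ^ 2)) := by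
    intro α γ
    have hsupp : (univ.filter fun i => (α • a + γ • y) i ≠ 0) ⊆ D ∪ T := by
      intro i hi
      by_contra hcon
      simp only [mem_union, not_or] at hcon
      simp [ha, hy, hcon.1, hcon.2] at hi
    have hc := (card_le_card hsupp).trans (card_union_le _ _)
    have hDcard : D.card ≤ S.card + S₁.card := card_union_le _ _
    have hsq : ∑ i, (α • a + γ • y) i ^ 2 = α ^ 2 * x2 + γ ^ 2 * (T.card * τ ^ 2) := by
      have hyy : ∑ i, y i ^ 2 = T.card * τ ^ 2 := by
        simp [hy, ite_pow]
      have hay : ∀ i, a i * y i = 0 := fun i => by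
        by_cases hi : i ∈ T
        · simp [ha, mem_compl.1 (hTD hi)]
        · simp [hy, hi]
      rw [← hyy, hx2, mul_sum, mul_sum, ← sum_add_distrib]
      refine sum_congr rfl fun i _ => ?_
      simp only [Pi.add_apply, Pi.smul_apply, smul_eq_mul]
      linear_combination 2 * α * γ * hay i
    have := hB (α • a + γ • y) (by omega)
    rwa [hsq, map_add, map_smul, map_smul] at this
  have hmain := rip_combination_le hδ0 hrip
  have hBa : ‖B a‖ ≤ Real.sqrt (1 + δ) * Real.sqrt x2 := by
    rw [← Real.sqrt_mul (by linarith)]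
    exact Real.le_sqrt_of_sq_le (by simpa using (hrip 1 0).2)
  have hcs : ‖B a‖ ^ 2 + inner ℝ (B a) (B y) ≤ Real.sqrt (1 + δ) * Real.sqrt x2 * ‖B s‖ := by
    have h4 := real_inner_le_norm (B a) (B s)
    have h5 := mul_le_mul_of_nonneg_right hBa (norm_nonneg (B s))
    linarith
  have hU : (T.card : ℝ) * τ ^ 2 ≤ r * τ ^ 2 :=
    mul_le_mul_of_nonneg_right (by exact_mod_cast hTcard.trans (Nat.sub_le _ _)) (sq_nonneg τ)
  have hKsq : Real.sqrt k ^ 2 = k := Real.sq_sqrt hk'.le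
  refine sub_le_of_quadratic_le (x := Real.sqrt x2) (U := T.card * τ ^ 2) hδ0 hδ1
    (Real.sqrt_pos.2 hk') hN0 (norm_nonneg _) ?_ ?_ ?_
  · rw [← Real.sqrt_mul hk'.le]
    refine Real.le_sqrt_of_sq_le (sq_sum_le_card_mul_sum_sq.trans ?_)
    have h7 : ∑ i ∈ S, s i ^ 2 ≤ x2 := by
      rw [hx2, ← sum_add_sum_compl S]
      have : ∑ i ∈ S, a i ^ 2 = ∑ i ∈ S, s i ^ 2 :=
        sum_congr rfl fun i hi => by simp [ha, hD, hi]
      rw [this]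
      exact le_add_of_nonneg_right (sum_nonneg fun i _ => sq_nonneg _)
    have h8 : (S.card : ℝ) ≤ k := by exact_mod_cast hS
    exact mul_le_mul h8 h7 (sum_nonneg fun i _ => sq_nonneg _) hk'.le
  · have h9 := mul_le_mul_of_nonneg_left hU (by positivity : 0 ≤ δ ^ 2 * k)
    have h10 := mul_le_mul_of_nonneg_right hδ (by positivity : 0 ≤ r * τ ^ 2)
    rw [hKsq, ← hrτ]
    linarith
  · rw [Real.sq_sqrt hx20]
    linarith

/-- Bessel's inequality for two vectors. -/
lemma Orthonormal.sum_inner_mul_inner_le {ι E : Type*} [Fintype ι] [NormedAddCommGroup E]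
    [InnerProductSpace ℝ E] {q r : ι → E} (hq : Orthonormal ℝ q) (hr : Orthonormal ℝ r) (x y : E) :
    ∑ i, inner ℝ (q i) x * inner ℝ (r i) y ≤ ‖x‖ * ‖y‖ := by
  refine (Real.sum_mul_le_sqrt_mul_sqrt _ _ _).trans ?_
  have h1 := hq.sum_inner_products_le x (s := univ)
  have h2 := hr.sum_inner_products_le y (s := univ)
  simp only [Real.norm_eq_abs, sq_abs] at h1 h2
  exact mul_le_mul (Real.sqrt_le_iff.2 ⟨norm_nonneg _, h1⟩)
    (Real.sqrt_le_iff.2 ⟨norm_nonneg _, h2⟩) (Real.sqrt_nonneg _) (norm_nonneg _)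

/-- The first `j` vectors of an orthonormal family are carried to those of another one by a
product of at most `j` reflections, which moves any orthonormal family by at most `2 * j`. -/
lemma exists_isometry_map_orthonormal {E : Type*} [NormedAddCommGroup E] [InnerProductSpace ℝ E]
    {n : ℕ} {v z : Fin n → E} (hv : Orthonormal ℝ v) (hz : Orthonormal ℝ z) (j : ℕ) :
    ∃ K : E →ₗᵢ[ℝ] E, (∀ i : Fin n, (i : ℕ) < j → K (v i) = z i) ∧
      ∀ {ι : Type} [Fintype ι] (q : ι → E), Orthonormal ℝ q →
        ∑ i, (1 - inner ℝ (q i) (K (q i))) ≤ 2 * j := by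
  induction j with
  | zero =>
    refine ⟨LinearIsometry.id, by simp, fun {ι} _ q hq => ?_⟩
    simp [hq.1]
  | succ j ih =>
    obtain ⟨K, hK, hKsum⟩ := ih
    by_cases hj : j < n
    swap
    · refine ⟨K, fun i _ => hK i (by omega), fun {ι} _ q hq => (hKsum q hq).trans ?_⟩
      push_cast
      linarith
    set y := K (v ⟨j, hj⟩) - z ⟨j, hj⟩ with hy
    set ρ : E ≃ₗᵢ[ℝ] E := (Submodule.span ℝ {y})ᗮ.reflection with hρ
    have hρx : ∀ x, ρ x = x - (2 * (inner ℝ y x / ‖y‖ ^ 2)) • y := fun x => by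
      rw [hρ, Submodule.reflection_orthogonal_apply, Submodule.reflection_singleton_apply,
        mul_smul, two_smul, two_smul]
      simp
    refine ⟨ρ.toLinearIsometry.comp K, fun i hi => ?_, fun {ι} _ q hq => ?_⟩
    · change ρ (K (v i)) = z i
      rcases (Nat.lt_succ_iff.1 hi).lt_or_eq with hlt | heq
      · have hne : (⟨j, hj⟩ : Fin n) ≠ i := fun h => by simp [← h] at hlt
        rw [hρx, hy, inner_sub_left, K.inner_map_map, hv.2 hne, hK i hlt, hz.2 hne]
        simp
      · obtain rfl : i = ⟨j, hj⟩ := Fin.ext heq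
        exact Submodule.reflection_sub (by rw [K.norm_map, hv.1, hz.1])
    · have h1 := hKsum q hq
      have h2 := hq.sum_inner_mul_inner_le (hq.comp_linearIsometry K) y y
      have h3 : ∑ i, (1 - inner ℝ (q i) ((ρ.toLinearIsometry.comp K) (q i))) =
          ∑ i, (1 - inner ℝ (q i) (K (q i))) +
            2 * ((∑ i, inner ℝ (q i) y * inner ℝ (K (q i)) y) / ‖y‖ ^ 2) := by
        rw [sum_div, mul_sum, ← sum_add_distrib]
        refine sum_congr rfl fun i _ => ?_
        change 1 - inner ℝ (q i) (ρ (K (q i))) = _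
        rw [hρx, inner_sub_right, inner_smul_right, real_inner_comm (K (q i)) y]
        ring
      have h4 : (∑ i, inner ℝ (q i) y * inner ℝ (K (q i)) y) / ‖y‖ ^ 2 ≤ 1 := by
        rw [pow_two]
        exact div_le_one_of_le₀ h2 (mul_self_nonneg _)
      rw [h3]
      push_cast
      linarith

/-- Every real matrix with at least as many columns as rows has a singular value decomposition,
and its nuclear norm is the sum of the singular values. -/
lemma exists_svd {n₁ n₂ : ℕ} (hn : n₁ ≤ n₂) (M : Matrix (Fin n₁) (Fin n₂) ℝ) :
    ∃ (s : Fin n₁ → ℝ) (p : OrthonormalBasis (Fin n₁) ℝ (EuclideanSpace ℝ (Fin n₁)))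
      (q : Fin n₁ → EuclideanSpace ℝ (Fin n₂)), (∀ i, 0 ≤ s i) ∧ Orthonormal ℝ q ∧
      M = ∑ i, rank1 (s i) (p i) (q i) ∧ nucNorm M = ∑ i, s i := by
  set hM := Matrix.isHermitian_mul_conjTranspose_self M
  set p := hM.eigenvectorBasis with hp
  set s : Fin n₁ → ℝ := fun i => Real.sqrt (hM.eigenvalues i) with hs
  have hnn : ∀ i, 0 ≤ hM.eigenvalues i :=
    (Matrix.posSemidef_self_mul_conjTranspose M).eigenvalues_nonneg
  have hs0 : ∀ i, 0 ≤ s i := fun i => Real.sqrt_nonneg _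
  set y : Fin n₁ → EuclideanSpace ℝ (Fin n₂) :=
    fun i => WithLp.toLp 2 (M.transpose.mulVec (p i)) with hy
  have hyy : ∀ i j, inner ℝ (y i) (y j) = if i = j then s i ^ 2 else 0 := fun i j => by
    have h1 : inner ℝ (y i) (y j) = inner ℝ (p i)
        (WithLp.toLp 2 ((M * M.conjTranspose).mulVec (p j))) := by
      simp only [hy, EuclideanSpace.inner_eq_star_dotProduct, star_trivial,
        Matrix.conjTranspose_eq_transpose_of_trivial]
      rw [← Matrix.mulVec_mulVec, dotProduct_comm, Matrix.mulVec_transpose,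
        ← Matrix.dotProduct_mulVec, dotProduct_comm]
    rw [h1, hM.mulVec_eigenvectorBasis, WithLp.toLp_smul, inner_smul_right]
    simp only [hs, Real.sq_sqrt (hnn i)]
    have := p.inner_eq_ite i j
    simp only [hp] at this ⊢
    simp only [WithLp.toLp_ofLp, this]
    split_ifs with h <;> simp [h]
  obtain ⟨b, hb⟩ := Orthonormal.exists_orthonormalBasis_extension_of_card_eq (𝕜 := ℝ)
    (E := EuclideanSpace ℝ (Fin n₂)) (ι := Fin n₂) (by simp)
    (v := fun j => if h : (j : ℕ) < n₁ then (s ⟨j, h⟩)⁻¹ • y ⟨j, h⟩ else 0)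
    (s := {j | ∃ h : (j : ℕ) < n₁, s ⟨j, h⟩ ≠ 0}) (by
      rw [orthonormal_iff_ite]
      rintro ⟨i, hi, hi'⟩ ⟨j, hj, hj'⟩
      simp only [Set.domRestrict_apply, hi, hj, dif_pos, inner_smul_left, inner_smul_right, hyy,
        Subtype.mk.injEq, Fin.ext_iff, conj_trivial]
      split_ifs with h
      · obtain rfl : i = j := Fin.ext h
        field_simp
      · simp)
  refine ⟨s, p, fun i => b (Fin.castLE hn i), hs0,
    b.orthonormal.comp _ (Fin.castLE_injective hn), ?_, rfl⟩
  have hyb : ∀ i, y i = s i • b (Fin.castLE hn i) := fun i => by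
    by_cases h : s i = 0
    · have := hyy i i
      simp only [h, if_true] at this
      rw [h, zero_smul]
      exact inner_self_eq_zero (𝕜 := ℝ) |>.1 (by rw [this]; ring)
    · rw [hb (Fin.castLE hn i) ⟨by simp, by simpa using h⟩]
      simp [smul_smul, h]
  ext a c
  have h1 := congrArg (fun w : EuclideanSpace ℝ (Fin n₁) => w a)
    (p.sum_repr' (WithLp.toLp 2 (fun a => M a c)))
  simp only [WithLp.ofLp_sum, Finset.sum_apply, WithLp.ofLp_smul, Pi.smul_apply, smul_eq_mul] at h1
  rw [Matrix.sum_apply, ← h1]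
  refine sum_congr rfl fun i _ => ?_
  have h2 := congrArg (fun w : EuclideanSpace ℝ (Fin n₂) => w c) (hyb i)
  simp only [hy, WithLp.ofLp_smul, Pi.smul_apply, smul_eq_mul] at h2
  have h3 : inner ℝ (p i) (WithLp.toLp 2 (fun a => M a c)) = M.transpose.mulVec (p i) c := by
    simp [EuclideanSpace.inner_eq_star_dotProduct, Matrix.mulVec, Matrix.transpose, dotProduct]
  rw [h3, h2, rank1, Matrix.of_apply]
  ring

/-- The Frobenius pairing of a matrix with a linear map. -/
noncomputable def frobPairing {n₁ n₂ : ℕ}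
    (G : EuclideanSpace ℝ (Fin n₂) →ₗ[ℝ] EuclideanSpace ℝ (Fin n₁)) :
    Matrix (Fin n₁) (Fin n₂) ℝ →ₗ[ℝ] ℝ where
  toFun M := ∑ a, ∑ b, M a b * G (EuclideanSpace.single b 1) a
  map_add' M M' := by simp [add_mul, sum_add_distrib]
  map_smul' c M := by simp [Finset.mul_sum, mul_assoc]

lemma frobPairing_rank1 {n₁ n₂ : ℕ}
    (G : EuclideanSpace ℝ (Fin n₂) →ₗ[ℝ] EuclideanSpace ℝ (Fin n₁)) (s : ℝ)
    (x : EuclideanSpace ℝ (Fin n₁)) (y : EuclideanSpace ℝ (Fin n₂)) :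
    frobPairing G (rank1 s x y) = s * inner ℝ x (G y) := by
  have hy : G y = ∑ b, y b • G (EuclideanSpace.single b 1) := by
    conv_lhs => rw [← (EuclideanSpace.basisFun (Fin n₂) ℝ).sum_repr y]
    simp
  have h1 : inner ℝ x (G y) = ∑ a, x a * G y a := by
    simp [PiLp.inner_apply, mul_comm]
  rw [h1, mul_sum]
  change ∑ a, ∑ b, rank1 s x y a b * G (EuclideanSpace.single b 1) a = _
  refine sum_congr rfl fun a _ => ?_
  rw [hy]
  simp only [rank1, Matrix.of_apply, WithLp.ofLp_sum, Finset.sum_apply, WithLp.ofLp_smul,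
    Pi.smul_apply, smul_eq_mul, mul_sum]
  exact sum_congr rfl fun b _ => by ring

lemma frobPairing_le_nucNorm {n₁ n₂ : ℕ} (hn : n₁ ≤ n₂)
    (G : EuclideanSpace ℝ (Fin n₂) →ₗ[ℝ] EuclideanSpace ℝ (Fin n₁)) (hG : ∀ y, ‖G y‖ ≤ ‖y‖)
    (M : Matrix (Fin n₁) (Fin n₂) ℝ) : frobPairing G M ≤ nucNorm M := by
  obtain ⟨s, p, q, hs, hq, hM, hnuc⟩ := exists_svd hn M
  rw [hnuc, hM, map_sum]
  refine sum_le_sum fun i _ => ?_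
  rw [frobPairing_rank1]
  refine mul_le_of_le_one_right (hs i) ((real_inner_le_norm _ _).trans ?_)
  have := hG (q i)
  rw [hq.1] at this
  rw [p.orthonormal.1, one_mul]
  exact this

/-- The linear map carrying the orthonormal family `q` to the orthonormal basis `p` and vanishing
on the orthogonal complement of `q`. -/
noncomputable def coisometry {n₁ n₂ : ℕ}
    (p : OrthonormalBasis (Fin n₁) ℝ (EuclideanSpace ℝ (Fin n₁)))
    (q : Fin n₁ → EuclideanSpace ℝ (Fin n₂)) :
    EuclideanSpace ℝ (Fin n₂) →ₗ[ℝ] EuclideanSpace ℝ (Fin n₁) where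
  toFun y := ∑ i, inner ℝ (q i) y • p i
  map_add' x y := by simp [inner_add_right, add_smul, sum_add_distrib]
  map_smul' c y := by simp [inner_smul_right, smul_sum, smul_smul]

lemma inner_coisometry {n₁ n₂ : ℕ}
    (p : OrthonormalBasis (Fin n₁) ℝ (EuclideanSpace ℝ (Fin n₁)))
    (q : Fin n₁ → EuclideanSpace ℝ (Fin n₂)) (i : Fin n₁) (y : EuclideanSpace ℝ (Fin n₂)) :
    inner ℝ (p i) (coisometry p q y) = inner ℝ (q i) y := by
  simp [coisometry, inner_sum, inner_smul_right, p.inner_eq_ite]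

lemma norm_coisometry_le {n₁ n₂ : ℕ}
    (p : OrthonormalBasis (Fin n₁) ℝ (EuclideanSpace ℝ (Fin n₁)))
    {q : Fin n₁ → EuclideanSpace ℝ (Fin n₂)} (hq : Orthonormal ℝ q)
    (y : EuclideanSpace ℝ (Fin n₂)) : ‖coisometry p q y‖ ≤ ‖y‖ := by
  refine abs_le_of_sq_le_sq' ?_ (norm_nonneg _) |>.2
  rw [← p.sum_sq_norm_inner_right]
  simp only [inner_coisometry]
  exact hq.sum_inner_products_le y

lemma nucNorm_sum_rank1_le {n₁ n₂ : ℕ} (hn : n₁ ≤ n₂) {σ : Fin n₁ → ℝ} (hσ : ∀ i, 0 ≤ σ i)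
    {u : Fin n₁ → EuclideanSpace ℝ (Fin n₁)} {v : Fin n₁ → EuclideanSpace ℝ (Fin n₂)}
    (hu : ∀ i, ‖u i‖ = 1) (hv : ∀ i, ‖v i‖ = 1) :
    nucNorm (∑ i, rank1 (σ i) (u i) (v i)) ≤ ∑ i, σ i := by
  obtain ⟨s, p, q, hs, hq, hM, hnuc⟩ := exists_svd hn (∑ i, rank1 (σ i) (u i) (v i))
  have h1 : frobPairing (coisometry p q) (∑ i, rank1 (σ i) (u i) (v i)) = ∑ i, s i := by
    rw [hM, map_sum]
    simp [frobPairing_rank1, inner_coisometry, hq.1]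
  rw [hnuc, ← h1, map_sum]
  refine sum_le_sum fun i _ => ?_
  rw [frobPairing_rank1]
  refine mul_le_of_le_one_right (hσ i) ((real_inner_le_norm _ _).trans ?_)
  have := norm_coisometry_le p hq (v i)
  rw [hv] at this
  rw [hu, one_mul]
  exact this

/-- A perturbation inequality for the nuclear norm of `X + H`, in terms of the singular values
`σ` of `X` and `s` of `H`. -/
lemma exists_le_nucNorm_add {n₁ n₂ : ℕ} (hn : n₁ ≤ n₂) (k : ℕ) {σ s : Fin n₁ → ℝ}
    (hσ : ∀ i, 0 ≤ σ i)
    {u : Fin n₁ → EuclideanSpace ℝ (Fin n₁)} {v : Fin n₁ → EuclideanSpace ℝ (Fin n₂)}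
    (hu : Orthonormal ℝ u) (hv : Orthonormal ℝ v)
    (p : OrthonormalBasis (Fin n₁) ℝ (EuclideanSpace ℝ (Fin n₁)))
    {q : Fin n₁ → EuclideanSpace ℝ (Fin n₂)} (hq : Orthonormal ℝ q) :
    ∃ S : Finset (Fin n₁), S.card ≤ k ∧
      ∑ i, σ i - 2 * ∑ i ∈ univ.filter (fun i : Fin n₁ => k ≤ (i : ℕ)), σ i
          + ∑ i ∈ Sᶜ, s i - ∑ i ∈ S, s i ≤
        nucNorm (∑ i, rank1 (σ i) (u i) (v i) + ∑ i, rank1 (s i) (p i) (q i)) := by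
  set z : Fin n₁ → EuclideanSpace ℝ (Fin n₂) := fun i => ∑ j, inner ℝ (p j) (u i) • q j with hz
  have hzo : Orthonormal ℝ z := by
    rw [orthonormal_iff_ite] at hu ⊢
    intro i j
    rw [← hu i j, ← p.sum_inner_mul_inner, hz, hq.inner_sum]
    exact sum_congr rfl fun l _ => by simp [real_inner_comm]
  have hcz : ∀ i, coisometry p q (z i) = u i := fun i => by
    refine Eq.trans ?_ (p.sum_repr' (u i))
    change ∑ j, inner ℝ (q j) (z i) • p j = _
    refine sum_congr rfl fun j _ => ?_
    rw [hz, hq.inner_right_fintype]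
  obtain ⟨K, hK, hKsum⟩ := exists_isometry_map_orthonormal hv hzo k
  set G := coisometry p q ∘ₗ K.toLinearMap with hG
  have hGn : ∀ y, ‖G y‖ ≤ ‖y‖ := fun y => by
    simpa [hG] using norm_coisometry_le p hq (K y)
  have hGv : ∀ i : Fin n₁, (i : ℕ) < k → G (v i) = u i := fun i hi => by
    simp [hG, hK i hi, hcz]
  set d : Fin n₁ → ℝ := fun i => 1 - inner ℝ (q i) (K (q i)) with hd
  have hin : ∀ i, |inner ℝ (q i) (K (q i))| ≤ 1 := fun i => by
    simpa [K.norm_map, hq.1] using abs_real_inner_le_norm (q i) (K (q i))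
  obtain ⟨S, -, hS, hSs⟩ := exists_subset_card_le_sum_le univ (fun i => -s i) d (τ := 2) k
    (fun i _ => by have := (abs_le.1 (hin i)).2; simp only [hd]; linarith)
    (fun i _ => by have := (abs_le.1 (hin i)).1; simp only [hd]; linarith)
    ((hKsum q hq).trans_eq (mul_comm _ _))
  refine ⟨S, hS, le_trans ?_ (frobPairing_le_nucNorm hn G hGn _)⟩
  have hX : ∑ i, σ i - 2 * ∑ i ∈ univ.filter (fun i : Fin n₁ => k ≤ (i : ℕ)), σ i ≤
      frobPairing G (∑ i, rank1 (σ i) (u i) (v i)) := by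
    rw [map_sum, sum_filter, mul_sum, ← sum_sub_distrib]
    refine sum_le_sum fun i _ => ?_
    rw [frobPairing_rank1]
    split_ifs with h
    · have h1 := abs_real_inner_le_norm (u i) (G (v i))
      have h2 := hGn (v i)
      rw [hv.1] at h2
      rw [hu.1, one_mul] at h1
      have h3 := (abs_le.1 (h1.trans h2)).1
      have := mul_le_mul_of_nonneg_left h3 (hσ i)
      linarith
    · rw [hGv i (not_le.1 h), real_inner_self_eq_norm_sq, hu.1]
      simp
  have hH : frobPairing G (∑ i, rank1 (s i) (p i) (q i)) = ∑ i, s i + ∑ i, -s i * d i := by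
    rw [map_sum, ← sum_add_distrib]
    refine sum_congr rfl fun i _ => ?_
    rw [frobPairing_rank1]
    simp only [hG, LinearMap.comp_apply, inner_coisometry, hd]
    change s i * inner ℝ (q i) (K (q i)) = _
    ring
  rw [map_add, hH, ← sum_add_sum_compl S s]
  rw [sum_neg_distrib] at hSs
  linarith

lemma sum_rank1_eq_mul {n₁ n₂ : ℕ} (c : Fin n₁ → ℝ) (p : Fin n₁ → Fin n₁ → ℝ)
    (q : Fin n₁ → Fin n₂ → ℝ) :
    ∑ i, rank1 (c i) (p i) (q i) =
      (Matrix.of p).transpose * (Matrix.diagonal c * Matrix.of q) := by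
  ext a b
  rw [Matrix.sum_apply, Matrix.mul_apply]
  exact sum_congr rfl fun i _ => by simp [rank1, Matrix.diagonal_mul]; ring

lemma rank_sum_rank1_le {n₁ n₂ : ℕ} (c : Fin n₁ → ℝ) (p : Fin n₁ → Fin n₁ → ℝ)
    (q : Fin n₁ → Fin n₂ → ℝ) :
    (∑ i, rank1 (c i) (p i) (q i)).rank ≤ (univ.filter fun i => c i ≠ 0).card := by
  rw [sum_rank1_eq_mul]
  refine (Matrix.rank_mul_le_right _ _).trans ((Matrix.rank_mul_le_left _ _).trans_eq ?_)
  rw [Matrix.rank_diagonal, Fintype.card_subtype]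

lemma frobNorm_sq_sum_rank1 {n₁ n₂ : ℕ} (c : Fin n₁ → ℝ)
    {p : Fin n₁ → EuclideanSpace ℝ (Fin n₁)} {q : Fin n₁ → EuclideanSpace ℝ (Fin n₂)}
    (hp : Orthonormal ℝ p) (hq : Orthonormal ℝ q) :
    frobNorm (∑ i, rank1 (c i) (p i) (q i)) ^ 2 = ∑ i, c i ^ 2 := by
  have hmul : ∀ {n : ℕ} {w : Fin n₁ → EuclideanSpace ℝ (Fin n)}, Orthonormal ℝ w →
      (Matrix.of fun i => ⇑(w i)) * (Matrix.of fun i => ⇑(w i)).transpose = 1 := by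
    intro n w hw
    ext i j
    have := orthonormal_iff_ite.1 hw i j
    rw [Matrix.one_apply, ← this]
    simp [Matrix.mul_apply, PiLp.inner_apply, mul_comm]
  have htr : ∀ M : Matrix (Fin n₁) (Fin n₂) ℝ, frobNorm M ^ 2 = (M * M.transpose).trace :=
    fun M => by
      refine (Real.sq_sqrt (sum_nonneg fun _ _ => sum_nonneg fun _ _ => sq_nonneg _)).trans ?_
      simp [Matrix.trace, Matrix.mul_apply, pow_two]
  rw [htr, sum_rank1_eq_mul]
  generalize hP : (Matrix.of fun i => ⇑(p i)) = P
  generalize hQ : (Matrix.of fun i => ⇑(q i)) = Q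
  have hP1 := hmul hp
  have hQ1 := hmul hq
  rw [hP] at hP1
  rw [hQ] at hQ1
  have : P.transpose * (Matrix.diagonal c * Q) * (P.transpose * (Matrix.diagonal c * Q)).transpose
      = P.transpose * (Matrix.diagonal c * (Q * Q.transpose) * Matrix.diagonal c * P) := by
    simp [Matrix.transpose_mul, Matrix.mul_assoc]
  rw [this, Matrix.trace_mul_comm, hQ1, Matrix.mul_one, Matrix.mul_assoc, hP1, Matrix.mul_one,
    Matrix.diagonal_mul_diagonal, Matrix.trace_diagonal]
  exact sum_congr rfl fun i _ => (pow_two _).symm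

/-- The map `c ↦ ∑ i, c i • p i (q i)ᵀ`. -/
noncomputable def synthesis {n₁ n₂ : ℕ} (p : Fin n₁ → Fin n₁ → ℝ) (q : Fin n₁ → Fin n₂ → ℝ) :
    (Fin n₁ → ℝ) →ₗ[ℝ] Matrix (Fin n₁) (Fin n₂) ℝ where
  toFun c := ∑ i, rank1 (c i) (p i) (q i)
  map_add' c d := by
    rw [← sum_add_distrib]
    exact sum_congr rfl fun i _ => by ext; simp [rank1]; ring
  map_smul' r c := by
    rw [smul_sum]
    exact sum_congr rfl fun i _ => by ext; simp [rank1]; ring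

lemma exists_order_of_rip_constant {t δ : ℝ} {k : ℕ} (hk : 0 < k) (ht : 1 < t) (hδ0 : 0 < δ)
    (hδ : δ < Real.sqrt ((t - 1) / t)) :
    δ < 1 ∧ ∃ r : ℕ, 0 < r ∧ ⌈t * (k : ℝ)⌉₊ = k + r ∧ δ ^ 2 * k ≤ (1 - δ ^ 2) * r := by
  have hk' : (0 : ℝ) < k := by exact_mod_cast hk
  have ht0 : 0 < t := by linarith
  have hδ2 : δ ^ 2 < (t - 1) / t := (Real.lt_sqrt hδ0.le).1 hδ
  rw [lt_div_iff₀ ht0] at hδ2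
  have hlt1 : δ ^ 2 < 1 := by nlinarith
  have hlt : k < ⌈t * (k : ℝ)⌉₊ := Nat.lt_ceil.2 (by nlinarith)
  obtain ⟨r, hr⟩ := Nat.exists_eq_add_of_lt hlt
  refine ⟨by nlinarith, r + 1, r.succ_pos, by omega, ?_⟩
  have hceil : t * k ≤ k + ((r + 1 : ℕ) : ℝ) := by
    have := Nat.le_ceil (t * (k : ℝ))
    rw [hr] at this
    push_cast at this ⊢
    linarith
  have h1 : (t - 1) * k ≤ ((r + 1 : ℕ) : ℝ) := by linarith
  have h2 := mul_le_mul_of_nonneg_left h1 (sub_nonneg.2 hlt1.le)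
  have h3 : δ ^ 2 * k ≤ (1 - δ ^ 2) * ((t - 1) * k) := by nlinarith
  exact h3.trans h2

lemma le_of_sq_sub_le {a s c : ℝ} (hs : 0 < s) (hc : 0 ≤ c) (h : a ^ 2 - 2 * s * a ≤ 2 * c) :
    a ≤ c / s + 2 * s := by
  have h0 : 0 ≤ c / s := by positivity
  have h1 : c = c / s * s := by field_simp
  by_contra! hcon
  nlinarith

lemma norm_sq_sub_le_of_minimizer {F : Type*} [NormedAddCommGroup F] [InnerProductSpace ℝ F]
    {e w : F} {ε lam N N' : ℝ} (hw : ‖w‖ ≤ ε) (hlam : 0 < lam)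
    (h : N' + (1 / (2 * lam)) * ‖w - e‖ ^ 2 ≤ N + (1 / (2 * lam)) * ‖w‖ ^ 2) :
    ‖e‖ ^ 2 - 2 * ε * ‖e‖ ≤ 2 * lam * (N - N') := by
  have h1 : ‖w - e‖ ^ 2 - ‖w‖ ^ 2 ≤ 2 * lam * (N - N') := by
    have := mul_le_mul_of_nonneg_left h (by positivity : 0 ≤ 2 * lam)
    have hl : ∀ x, 2 * lam * (1 / (2 * lam) * x) = x := fun x => by field_simp
    rw [mul_add, mul_add, hl, hl] at this
    linarith
  rw [norm_sub_sq_real] at h1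
  have h2 := real_inner_le_norm w e
  have h3 := mul_le_mul_of_nonneg_right hw (norm_nonneg e)
  linarith

theorem stmt0 {n₁ n₂ m k : ℕ} (hk : 0 < k) (hn : n₁ ≤ n₂)
    (A : Matrix (Fin n₁) (Fin n₂) ℝ →ₗ[ℝ] EuclideanSpace ℝ (Fin m))
    (t δ : ℝ) (ht : 1 < t) (hδ0 : 0 < δ)
    (hδ : δ < Real.sqrt ((t - 1) / t))
    (hRIP : HasRIP A ⌈t * (k : ℝ)⌉₊ δ)
    (X : Matrix (Fin n₁) (Fin n₂) ℝ)
    -- SVD of `X`, with singular values `σ` in decreasing order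
    (σ : Fin n₁ → ℝ) (u : Fin n₁ → Fin n₁ → ℝ) (v : Fin n₁ → Fin n₂ → ℝ)
    (hσ0 : ∀ i, 0 ≤ σ i) (hσmono : ∀ i j : Fin n₁, i ≤ j → σ j ≤ σ i)
    (hu : ∀ i j, ∑ a, u i a * u j a = if i = j then (1 : ℝ) else 0)
    (hv : ∀ i j, ∑ b, v i b * v j b = if i = j then (1 : ℝ) else 0)
    (hX : X = ∑ i, rank1 (σ i) (u i) (v i))
    (nv : EuclideanSpace ℝ (Fin m)) (ε : ℝ) (hnv : ‖nv‖ ≤ ε)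
    (b : EuclideanSpace ℝ (Fin m)) (hb : b = A X + nv)
    (lam : ℝ) (hlam : 0 < lam)
    (Xs : Matrix (Fin n₁) (Fin n₂) ℝ)
    (hXs : ∀ Z : Matrix (Fin n₁) (Fin n₂) ℝ,
      nucNorm Xs + (1 / (2 * lam)) * ‖b - A Xs‖ ^ 2 ≤
        nucNorm Z + (1 / (2 * lam)) * ‖b - A Z‖ ^ 2)
    (β₁ C₁ C₂ : ℝ)
    (hβ₁ : β₁ = 2 / ((1 - δ) * Real.sqrt (1 + δ)))
    (hC₁ : C₁ = 2 * lam / (Real.sqrt k * β₁ * lam + ε))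
    (hC₂ : C₂ = 2 * Real.sqrt k * β₁ * lam + 2 * ε) :
    ‖A (Xs - X)‖ ≤ C₁ * (∑ i ∈ univ.filter fun i : Fin n₁ => k ≤ (i : ℕ), σ i) + C₂ := by
  have hk' : (0 : ℝ) < k := by exact_mod_cast hk
  obtain ⟨hδ1, r, hr0, hr, hδr⟩ := exists_order_of_rip_constant hk ht hδ0 hδ
  obtain ⟨s, p, q, hs, hq, hH, -⟩ := exists_svd hn (Xs - X)
  have hu' : Orthonormal ℝ fun i => WithLp.toLp 2 (u i) := orthonormal_iff_ite.2 fun i j => by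
    rw [← hu i j]
    simp [PiLp.inner_apply, mul_comm]
  have hv' : Orthonormal ℝ fun i => WithLp.toLp 2 (v i) := orthonormal_iff_ite.2 fun i j => by
    rw [← hv i j]
    simp [PiLp.inner_apply, mul_comm]
  obtain ⟨S, hS, hnuc⟩ := exists_le_nucNorm_add hn k hσ0 hu' hv' p hq
  have hXnuc : nucNorm X ≤ ∑ i, σ i := by
    rw [hX]
    exact nucNorm_sum_rank1_le hn hσ0 (u := fun i => WithLp.toLp 2 (u i))
      (v := fun i => WithLp.toLp 2 (v i)) hu'.1 hv'.1
  rw [← hH, ← hX, add_sub_cancel] at hnuc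
  have hnull := sum_sub_sum_compl_le_of_rip (A ∘ₗ synthesis (fun i => p i) (fun i => q i)) hk hr0
    hδ0 hδ1 hδr (fun c hc => by
      have := hRIP (synthesis (fun i => p i) (fun i => q i) c)
        ((rank_sum_rank1_le _ _ _).trans (hr ▸ hc))
      have hfrob : frobNorm (synthesis (fun i => p i) (fun i => q i) c) ^ 2 = ∑ i, c i ^ 2 :=
        frobNorm_sq_sum_rank1 c p.orthonormal hq
      rwa [hfrob] at this) s hs S hS
  have hsyn : (A ∘ₗ synthesis (fun i => p i) (fun i => q i)) s = A (Xs - X) := by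
    rw [hH]
    rfl
  rw [hsyn, ← hβ₁] at hnull
  have hmin := hXs X
  have hbX : b - A X = nv := by rw [hb, add_sub_cancel_left]
  have hbXs : b - A Xs = nv - A (Xs - X) := by rw [hb, map_sub]; abel
  rw [hbX, hbXs] at hmin
  have hquad := norm_sq_sub_le_of_minimizer hnv hlam hmin
  set T := ∑ i ∈ univ.filter fun i : Fin n₁ => k ≤ (i : ℕ), σ i
  have hT : 0 ≤ T := sum_nonneg fun i _ => hσ0 i
  have hβ0 : 0 < β₁ := by
    rw [hβ₁]
    have : 0 < 1 - δ := by linarith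
    positivity
  have hε : 0 ≤ ε := (norm_nonneg nv).trans hnv
  have hdiff : nucNorm X - nucNorm Xs ≤ 2 * T + Real.sqrt k * β₁ * ‖A (Xs - X)‖ := by linarith
  have hscaled := mul_le_mul_of_nonneg_left hdiff (by positivity : 0 ≤ 2 * lam)
  have hfin := le_of_sq_sub_le (a := ‖A (Xs - X)‖) (s := Real.sqrt k * β₁ * lam + ε)
    (c := 2 * lam * T) (by positivity) (by positivity) (by linarith)
  rw [hC₁, hC₂, div_mul_eq_mul_div]
  linarith
end

section
/- Let A : ℝ^{n₁×n₂} → ℝ^m be a linear map satisfying the RIP of order ⌈tk⌉ with restricted isometry constant δ_{tk} satisfying δ_{tk} < √((t−1)/t) for some fixed t > 1 and positive integer k. Let X ∈ ℝ^{n₁×n₂}, let n ∈ ℝ^m with ‖n‖₂ ≤ ε, let b = A(X) + n, let λ > 0, and let X♯ be any minimizer of the regularized nuclear norm problem min_Z ‖Z‖_* + (1/(2λ))‖b − A(Z)‖₂². Then ‖X♯ − X‖_F ≤ C₃‖X − X_{[k]}‖_* + C₄, where β₁ = 2/((1−δ_{tk})√(1+δ_{tk})), β₂ = δ_{tk}/√((1−δ_{tk}²)(t−1)),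 C₃ = [2√k·β₁(2√k + 1 + β₂)λ + 2(√k·β₂ + 2β₂ + √k)ε] / (k·β₁(1−β₂)λ), and C₄ = [2(k + √k)β₁λ + (β₂ + 2√k − √k·β₂)ε]·(√k·β₁·λ + ε) / (√k(1−β₂)λ). -/
open Finset

/-- A lower bound for the `0`-`α` valued weights supported on at most `j` indices extends to all
`[0, α]`-valued weights of total mass at most `j * α`. -/
theorem sum_mul_ge_of_sparse_sum_ge {ι : Type*} [DecidableEq ι] (R : Finset ι) (l τ : ι → ℝ)
    (α c : ℝ) (j : ℕ) (hτ0 : ∀ i ∈ R, 0 ≤ τ i) (hτ1 : ∀ i ∈ R, τ i ≤ α)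
    (hsum : ∑ i ∈ R, τ i ≤ j * α)
    (h : ∀ J ⊆ R, J.card ≤ j → c ≤ α * ∑ i ∈ J, l i) :
    c ≤ ∑ i ∈ R, τ i * l i := by
  obtain ⟨J, hJ, hmin⟩ := exists_min_image (R.powerset.filter fun J => J.card ≤ j)
    (fun J => ∑ i ∈ J, l i) ⟨∅, by simp⟩
  simp only [mem_filter, mem_powerset] at hJ hmin
  obtain ⟨hJR, hJj⟩ := hJ
  obtain ⟨θ, hθ0, hin, hout, hcard⟩ : ∃ θ : ℝ, θ ≤ 0 ∧ (∀ a ∈ J, l a ≤ θ) ∧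
      (∀ b ∈ R \ J, θ ≤ l b) ∧ θ * j = θ * J.card := by
    have hneg : ∀ a ∈ J, l a ≤ 0 := by
      intro a ha
      have := hmin (J.erase a) ⟨(erase_subset _ _).trans hJR, (card_erase_le).trans hJj⟩
      rw [← add_sum_erase J l ha] at this
      linarith
    rcases hJj.lt_or_eq with hlt | heq
    · refine ⟨0, le_rfl, hneg, ?_, by simp⟩
      intro b hb
      rw [mem_sdiff] at hb
      have := hmin (insert b J) ⟨insert_subset hb.1 hJR, (card_insert_le _ _).trans hlt⟩
      rw [sum_insert hb.2] at this
      linarith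
    · rcases J.eq_empty_or_nonempty with rfl | hne
      · by_cases hR : R.Nonempty
        · obtain ⟨b, hb, hbmin⟩ := exists_min_image R l hR
          refine ⟨min 0 (l b), min_le_left _ _, by simp, ?_, by simp [← heq]⟩
          intro i hi
          exact (min_le_right _ _).trans (hbmin i (by simpa using hi))
        · rw [not_nonempty_iff_eq_empty] at hR
          exact ⟨0, le_rfl, by simp, by simp [hR], by simp⟩
      · obtain ⟨a, ha, hamax⟩ := exists_max_image J l hne
        refine ⟨l a, hneg a ha, hamax, ?_, by rw [heq]⟩
        intro b hb
        rw [mem_sdiff] at hb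
        have hb' : b ∉ J.erase a := fun hh => hb.2 (mem_of_mem_erase hh)
        have := hmin (insert b (J.erase a))
          ⟨insert_subset hb.1 ((erase_subset _ _).trans hJR), by
            rw [card_insert_of_notMem hb', card_erase_of_mem ha]
            have := card_pos.2 hne
            omega⟩
        rw [sum_insert hb', ← add_sum_erase J l ha] at this
        linarith
  have h1 := h J hJR hJj
  have h2 : ∀ i ∈ R, (if i ∈ J then α * (l i - θ) else 0) + τ i * θ ≤ τ i * l i := by
    intro i hi
    split_ifs with hiJ
    · nlinarith [hin i hiJ, hτ1 i hi,
        mul_nonneg (sub_nonneg.2 (hτ1 i hi)) (sub_nonneg.2 (hin i hiJ))]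
    · nlinarith [hout i (mem_sdiff.2 ⟨hi, hiJ⟩), hτ0 i hi,
        mul_nonneg (hτ0 i hi) (sub_nonneg.2 (hout i (mem_sdiff.2 ⟨hi, hiJ⟩)))]
  have h3 := sum_le_sum h2
  rw [sum_add_distrib, ← sum_mul, sum_ite_mem, inter_eq_right.2 hJR, ← mul_sum,
    sum_sub_distrib, sum_const, nsmul_eq_mul] at h3
  have h4 : θ * (j * α) ≤ θ * ∑ i ∈ R, τ i := mul_le_mul_of_nonpos_left hsum hθ0
  nlinarith [h3, h4, h1, hcard, congrArg (· * α) hcard]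

/-- Robust null space property of a family satisfying a restricted isometry property. Here `x` is
the norm of `τ` on `K` together with the large coordinates outside `K`. -/
theorem sparse_null_space_bound {ι W : Type*} [Fintype ι] [DecidableEq ι]
    [NormedAddCommGroup W] [InnerProductSpace ℝ W] (a : ι → W) (k s : ℕ) (δ : ℝ)
    (hδ0 : 0 < δ) (hs : 0 < s)
    (hRIP : ∀ (c : ι → ℝ) (I : Finset ι), I.card ≤ k + s → (∀ i ∉ I, c i = 0) →
      (1 - δ) * ∑ i, c i ^ 2 ≤ ‖∑ i, c i • a i‖ ^ 2 ∧
        ‖∑ i, c i • a i‖ ^ 2 ≤ (1 + δ) * ∑ i, c i ^ 2)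
    (τ : ι → ℝ) (hτ : ∀ i, 0 ≤ τ i) (K : Finset ι) (hK : K.card ≤ k) :
    ∃ x : ℝ, 0 ≤ x ∧ ∑ i ∈ K, τ i ^ 2 ≤ x ^ 2 ∧
      ∑ i, τ i ^ 2 ≤ x ^ 2 + (∑ i ∈ Kᶜ, τ i) ^ 2 ∧
      (1 - δ ^ 2) * x ^ 2 ≤ 2 * (√(1 + δ) * x * ‖∑ i, τ i • a i‖) +
        δ ^ 2 * ((∑ i ∈ Kᶜ, τ i) ^ 2 / s) := by
  set T := ∑ i ∈ Kᶜ, τ i with hT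
  have hT0 : 0 ≤ T := sum_nonneg fun i _ => hτ i
  have hs' : (0 : ℝ) < s := by exact_mod_cast hs
  set α := T / s with hα
  have hα0 : 0 ≤ α := by positivity
  have hTα : T = s * α := by rw [hα]; field_simp
  set L := Kᶜ.filter fun i => α < τ i with hL
  set R := Kᶜ.filter fun i => ¬ α < τ i with hR
  have hLR : ∑ i ∈ L, τ i + ∑ i ∈ R, τ i = T := sum_filter_add_sum_filter_not _ _ _
  have hLsum : L.card * α ≤ ∑ i ∈ L, τ i := by
    rw [← nsmul_eq_mul]
    exact card_nsmul_le_sum _ _ _ fun i hi => (mem_filter.1 hi).2.le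
  have hRnn : 0 ≤ ∑ i ∈ R, τ i := sum_nonneg fun i _ => hτ i
  have hLs : L.card ≤ s := by
    rcases L.eq_empty_or_nonempty with h | h
    · simp [h]
    · have h1 : L.card * α < ∑ i ∈ L, τ i := by
        rw [← nsmul_eq_mul, ← sum_const]
        exact sum_lt_sum_of_nonempty h fun i hi => (mem_filter.1 hi).2
      have h2 : (L.card : ℝ) * α < s * α := by linarith
      exact_mod_cast (lt_of_mul_lt_mul_right h2 hα0).le
  obtain ⟨j, hj⟩ := Nat.exists_eq_add_of_le hLs
  have hj' : (s : ℝ) = L.card + j := by exact_mod_cast hj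
  set I := K ∪ L with hI
  have hKL : Disjoint K L := disjoint_left.2 fun i h1 h2 => by
    simp [hL, h1] at h2
  have hIR : Disjoint I R := disjoint_left.2 fun i h1 h2 => by
    simp only [hI, hL, hR, mem_union, mem_filter, mem_compl] at h1 h2
    tauto
  have huniv : I ∪ R = univ := by
    ext i
    simp only [hI, hL, hR, mem_union, mem_filter, mem_compl, mem_univ, iff_true]
    tauto
  have hIcard : I.card + j ≤ k + s := by
    have := card_union_le K L
    rw [hI]
    omega
  set x := √(∑ i ∈ I, τ i ^ 2) with hx
  have hx2 : x ^ 2 = ∑ i ∈ I, τ i ^ 2 := Real.sq_sqrt (sum_nonneg fun i _ => sq_nonneg _)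
  have hx0 : 0 ≤ x := Real.sqrt_nonneg _
  set p := ∑ i ∈ I, τ i • a i with hp
  have hsplit : ∀ f : ι → W, ∑ i, f i = ∑ i ∈ I, f i + ∑ i ∈ R, f i := fun f => by
    rw [← sum_union hIR, huniv]
  have hsplit' : ∀ f : ι → ℝ, ∑ i, f i = ∑ i ∈ I, f i + ∑ i ∈ R, f i := fun f => by
    rw [← sum_union hIR, huniv]
  have hcomb : ∀ (J : Finset ι), J ⊆ R → J.card ≤ j → ∀ μ ν : ℝ,
      (1 - δ) * (μ ^ 2 * x ^ 2 + ν ^ 2 * J.card) ≤ ‖μ • p + ν • ∑ i ∈ J, a i‖ ^ 2 ∧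
      ‖μ • p + ν • ∑ i ∈ J, a i‖ ^ 2 ≤ (1 + δ) * (μ ^ 2 * x ^ 2 + ν ^ 2 * J.card) := by
    intro J hJ hJj μ ν
    have hIJ : Disjoint I J := hIR.mono_right hJ
    have hnI : ∀ i ∈ J, i ∉ I := fun i hi hi' => disjoint_left.1 hIJ hi' hi
    have key := hRIP (fun i => (if i ∈ I then μ * τ i else 0) + (if i ∈ J then ν else 0)) (I ∪ J)
      ((card_union_le _ _).trans (by omega)) (fun i hi => by
        simp only [mem_union, not_or] at hi
        simp [hi.1, hi.2])
    have e1 : ∑ i, ((if i ∈ I then μ * τ i else 0) + (if i ∈ J then ν else 0)) • a i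
        = μ • p + ν • ∑ i ∈ J, a i := by
      simp only [add_smul, sum_add_distrib, ite_smul, zero_smul, sum_ite_mem, univ_inter, hp,
        smul_sum, mul_smul]
    have e2 : ∑ i, ((if i ∈ I then μ * τ i else 0) + (if i ∈ J then ν else 0)) ^ 2
        = μ ^ 2 * x ^ 2 + ν ^ 2 * J.card := by
      have : ∀ i, ((if i ∈ I then μ * τ i else 0) + (if i ∈ J then ν else 0)) ^ 2
          = (if i ∈ I then μ ^ 2 * τ i ^ 2 else 0) + (if i ∈ J then ν ^ 2 else 0) := by
        intro i
        by_cases h1 : i ∈ I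
        · have h2 : i ∉ J := fun h => hnI i h h1
          simp [h1, h2, mul_pow]
        · by_cases h2 : i ∈ J <;> simp [h1, h2]
      simp only [this, sum_add_distrib, sum_ite_mem, univ_inter, hx2, mul_sum, sum_const,
        nsmul_eq_mul]
      ring
    rw [e1, e2] at key
    exact key
  have hpn : ‖p‖ ≤ √(1 + δ) * x := by
    have := (hcomb ∅ (empty_subset _) (by simp) 1 0).2
    simp only [one_smul, zero_smul, add_zero] at this
    refine abs_le_of_sq_le_sq' ?_ (by positivity) |>.2
    rw [mul_pow, Real.sq_sqrt (by linarith)]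
    linarith
  have hexp : ∀ (μ ν : ℝ) (w : W), ‖μ • p + ν • w‖ ^ 2 =
      μ ^ 2 * ‖p‖ ^ 2 + 2 * (μ * ν * inner ℝ p w) + ν ^ 2 * ‖w‖ ^ 2 := by
    intro μ ν w
    rw [norm_add_sq_real, real_inner_smul_left, real_inner_smul_right, norm_smul, norm_smul,
      mul_pow ‖μ‖, mul_pow ‖ν‖, Real.norm_eq_abs, Real.norm_eq_abs, sq_abs, sq_abs]
    ring
  have hlin : ∀ J ⊆ R, J.card ≤ j → ((1 - δ ^ 2) * x ^ 2 - δ ^ 2 * (T ^ 2 / s)) / 2 - ‖p‖ ^ 2 ≤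
      α * ∑ i ∈ J, inner ℝ p (a i) := by
    intro J hJ hJj
    have h1 := (hcomb J hJ hJj (1 + δ) (δ * α)).1
    have h2 := (hcomb J hJ hJj (1 - δ) (-(δ * α))).2
    rw [hexp, inner_sum] at h1 h2
    have h3 : α ^ 2 * J.card ≤ T ^ 2 / s := by
      have : T ^ 2 / s = α ^ 2 * s := by
        rw [div_eq_iff hs'.ne', hTα]
        ring
      rw [this]
      refine mul_le_mul_of_nonneg_left ?_ (sq_nonneg _)
      have : (J.card : ℝ) ≤ j := by exact_mod_cast hJj
      have : (0 : ℝ) ≤ L.card := Nat.cast_nonneg _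
      linarith
    have h4 : δ * (2 * (1 - δ ^ 2) * x ^ 2 - 2 * δ ^ 2 * (α ^ 2 * J.card)) ≤
        δ * (4 * (‖p‖ ^ 2 + α * ∑ i ∈ J, inner ℝ p (a i))) := by
      nlinarith [h1, h2]
    have h5 := le_of_mul_le_mul_left h4 hδ0
    have h6 := mul_le_mul_of_nonneg_left h3 (sq_nonneg δ)
    linarith
  have hfin := sum_mul_ge_of_sparse_sum_ge R (fun i => inner ℝ p (a i)) τ α _ j
    (fun i _ => hτ i) (fun i hi => not_lt.1 (mem_filter.1 hi).2)
    (by nlinarith) hlin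
  refine ⟨x, hx0, ?_, ?_, ?_⟩
  · rw [hx2]
    exact sum_le_sum_of_subset_of_nonneg subset_union_left fun i _ _ => sq_nonneg _
  · rw [hsplit', hx2]
    have h1 : ∑ i ∈ R, τ i ^ 2 ≤ (∑ i ∈ R, τ i) ^ 2 :=
      sum_sq_le_sq_sum_of_nonneg fun i _ => hτ i
    have h2 : (∑ i ∈ R, τ i) ^ 2 ≤ T ^ 2 := by
      have := sum_nonneg (s := L) fun i _ => hτ i
      gcongr
      linarith
    linarith
  · have h1 : inner ℝ p (∑ i, τ i • a i) = ‖p‖ ^ 2 + ∑ i ∈ R, τ i * inner ℝ p (a i) := by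
      rw [hsplit, inner_add_right, real_inner_self_eq_norm_sq, inner_sum]
      simp only [inner_smul_right]
    have h2 := real_inner_le_norm p (∑ i, τ i • a i)
    have h3 := mul_le_mul_of_nonneg_right hpn (norm_nonneg (∑ i, τ i • a i))
    linarith

theorem exists_sorted_diagonalization {V κ : Type*} [NormedAddCommGroup V] [InnerProductSpace ℝ V]
    [FiniteDimensional ℝ V] [Fintype κ] {N : ℕ} (hN : Module.finrank ℝ V = N)
    (s : κ → ℝ) (q : κ → V) :
    ∃ (b : OrthonormalBasis (Fin N) ℝ V) (γ : Fin N → ℝ), Antitone γ ∧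
      (∀ z, ∑ i, s i * inner ℝ (q i) z ^ 2 = ∑ i, γ i * inner ℝ (b i) z ^ 2) ∧
      ∑ i, γ i = ∑ i, s i * ‖q i‖ ^ 2 := by
  set T : V →ₗ[ℝ] V := ∑ i, s i • (innerₛₗ ℝ (q i)).smulRight (q i) with hT
  have hTz : ∀ y z, inner ℝ y (T z) = ∑ i, s i * (inner ℝ (q i) y * inner ℝ (q i) z) := by
    intro y z
    simp only [hT, LinearMap.sum_apply, LinearMap.smul_apply, LinearMap.smulRight_apply,
      inner_sum, real_inner_smul_right, innerₛₗ_apply_apply]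
    refine sum_congr rfl fun i _ => ?_
    rw [real_inner_comm (q i) y]
    ring
  have hsym : T.IsSymmetric := by
    intro y z
    rw [real_inner_comm, hTz, hTz]
    refine sum_congr rfl fun i _ => ?_
    ring
  refine ⟨hsym.eigenvectorBasis hN, hsym.eigenvalues hN, hsym.eigenvalues_antitone hN, ?_, ?_⟩
  · intro z
    have h1 := hTz z z
    rw [← (hsym.eigenvectorBasis hN).sum_inner_mul_inner] at h1
    simp only [← pow_two] at h1
    rw [← h1]
    refine sum_congr rfl fun i _ => ?_
    rw [← hsym, hsym.apply_eigenvectorBasis hN, real_inner_comm _ z]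
    simp only [RCLike.ofReal_real_eq_id, id, real_inner_smul_left]
    ring
  · have h1 : ∀ i, hsym.eigenvalues hN i =
        ∑ l, s l * inner ℝ (q l) (hsym.eigenvectorBasis hN i) ^ 2 := by
      intro i
      have := hTz (hsym.eigenvectorBasis hN i) (hsym.eigenvectorBasis hN i)
      rw [hsym.apply_eigenvectorBasis hN] at this
      simpa only [RCLike.ofReal_real_eq_id, id, real_inner_smul_right, real_inner_self_eq_norm_sq,
        OrthonormalBasis.norm_eq_one, one_pow, mul_one, ← pow_two] using this
    simp only [h1]
    rw [sum_comm]
    refine sum_congr rfl fun l _ => ?_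
    rw [← mul_sum]
    congr 1
    exact (hsym.eigenvectorBasis hN).sum_sq_inner_left (q l)

theorem exists_combination_orthogonal {V ι κ : Type*} [NormedAddCommGroup V]
    [InnerProductSpace ℝ V] {w : ι → V} (hw : Orthonormal ℝ w) (y : κ → V)
    (A : Finset ι) (B : Finset κ) (h : B.card < A.card) :
    ∃ (c : ι → ℝ), ∑ i ∈ A, c i • w i ≠ 0 ∧
      ∀ l ∈ B, inner ℝ (y l) (∑ i ∈ A, c i • w i) = 0 := by
  classical
  let F : (A → ℝ) →ₗ[ℝ] (B → ℝ) :=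
    (LinearMap.pi fun l : B => innerₛₗ ℝ (y l)) ∘ₗ Fintype.linearCombination ℝ fun a : A => w a
  have hker : LinearMap.ker F ≠ ⊥ := F.ker_ne_bot_of_finrank_lt (by simpa using h)
  obtain ⟨c, hc, hc0⟩ := Submodule.exists_mem_ne_zero_of_ne_bot hker
  have hsum : ∑ i ∈ A, (fun i => if hi : i ∈ A then c ⟨i, hi⟩ else 0) i • w i =
      Fintype.linearCombination ℝ (fun a : A => w a) c := by
    rw [Fintype.linearCombination_apply, ← sum_coe_sort A]
    simp
  refine ⟨fun i => if hi : i ∈ A then c ⟨i, hi⟩ else 0, ?_, ?_⟩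
  · rw [hsum]
    intro h0
    have hli := (hw.comp (fun a : A => (a : ι)) Subtype.val_injective).linearIndependent
    rw [Fintype.linearIndependent_iff] at hli
    exact hc0 (funext (hli c (by simpa [Fintype.linearCombination_apply] using h0)))
  · intro l hl
    rw [hsum]
    exact congrFun (LinearMap.mem_ker.1 hc) ⟨l, hl⟩

section Weyl

variable {V : Type*} [NormedAddCommGroup V] [InnerProductSpace ℝ V] {n N : ℕ} {e f : Fin n → V}
  {σ : Fin n → ℝ} {b : OrthonormalBasis (Fin N) ℝ V} {γ : Fin N → ℝ}

theorem le_sorted_eigenvalue (he : Orthonormal ℝ e)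
    (hef : ∀ i j, inner ℝ (e i) (f j) = 0) (hσ : Antitone σ) (hγ : Antitone γ)
    (hform : ∀ z, ∑ i, σ i * (inner ℝ (e i) z ^ 2 - inner ℝ (f i) z ^ 2) ≤
      ∑ i, γ i * inner ℝ (b i) z ^ 2) (j : Fin n) (r : Fin N) (hr : (r : ℕ) = j) :
    σ j ≤ γ r := by
  obtain ⟨c, hz0, hzb⟩ := exists_combination_orthogonal he b (Iic j) (Iio r) (by simp [hr])
  set z := ∑ i ∈ Iic j, c i • e i with hz
  have hfz : ∀ l, inner ℝ (f l) z = 0 := fun l => by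
    rw [hz, inner_sum]
    refine sum_eq_zero fun i _ => ?_
    rw [real_inner_smul_right, real_inner_comm, hef, mul_zero]
  have hez : ∀ l ∈ Iic j, inner ℝ (e l) z = c l := fun l hl => he.inner_right_sum c hl
  have hez' : ∀ l ∉ Iic j, inner ℝ (e l) z = 0 := fun l hl => by
    rw [hz, inner_sum]
    refine sum_eq_zero fun i hi => ?_
    rw [real_inner_smul_right, he.2 (by rintro rfl; exact hl hi), mul_zero]
  have hnorm : ‖z‖ ^ 2 = ∑ i, inner ℝ (e i) z ^ 2 := by
    rw [← real_inner_self_eq_norm_sq]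
    nth_rewrite 1 [hz]
    rw [sum_inner, ← sum_subset (subset_univ (Iic j))]
    · refine sum_congr rfl fun i hi => ?_
      rw [real_inner_smul_left, hez i hi, pow_two]
    · intro i _ hi
      rw [hez' i hi]; simp
  have hpos : 0 < ‖z‖ ^ 2 := by positivity
  refine le_of_mul_le_mul_right ?_ hpos
  calc σ j * ‖z‖ ^ 2 ≤ ∑ i, σ i * (inner ℝ (e i) z ^ 2 - inner ℝ (f i) z ^ 2) := by
        rw [hnorm, mul_sum]
        refine sum_le_sum fun i _ => ?_
        rw [hfz]
        by_cases hi : i ∈ Iic j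
        · have := mul_le_mul_of_nonneg_right (hσ (mem_Iic.1 hi)) (sq_nonneg (inner ℝ (e i) z))
          linarith
        · simp [hez' i hi]
    _ ≤ ∑ i, γ i * inner ℝ (b i) z ^ 2 := hform z
    _ ≤ γ r * ‖z‖ ^ 2 := by
        rw [← b.sum_sq_inner_right, mul_sum]
        refine sum_le_sum fun i _ => ?_
        by_cases hi : i ∈ Iio r
        · simp [hzb i hi]
        · exact mul_le_mul_of_nonneg_right (hγ (by simpa using hi)) (sq_nonneg _)

theorem neg_le_sorted_eigenvalue (hf : Orthonormal ℝ f) (hσ0 : ∀ i, 0 ≤ σ i) (hγ : Antitone γ)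
    (hform : ∀ z, ∑ i, σ i * (inner ℝ (e i) z ^ 2 - inner ℝ (f i) z ^ 2) ≤
      ∑ i, γ i * inner ℝ (b i) z ^ 2) (B : Finset (Fin n)) (r : Fin N)
    (hr : B.card + r < N) (ρ : ℝ) (hρ0 : 0 ≤ ρ) (hρ : ∀ i ∉ B, σ i ≤ ρ) :
    -ρ ≤ γ r := by
  obtain ⟨c, hz0, hzf⟩ := exists_combination_orthogonal b.orthonormal f (Ici r) B (by
    simp; omega)
  set z := ∑ i ∈ Ici r, c i • b i with hz
  have hbz : ∀ l ∉ Ici r, inner ℝ (b l) z = 0 := fun l hl => by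
    rw [hz, inner_sum]
    refine sum_eq_zero fun i hi => ?_
    rw [real_inner_smul_right, b.orthonormal.2 (by rintro rfl; exact hl hi), mul_zero]
  have hpos : 0 < ‖z‖ ^ 2 := by positivity
  refine le_of_mul_le_mul_right ?_ hpos
  calc -ρ * ‖z‖ ^ 2 ≤ -ρ * ∑ i, inner ℝ (f i) z ^ 2 := by
        have := hf.sum_inner_products_le z (s := univ)
        simp only [Real.norm_eq_abs, sq_abs] at this
        exact mul_le_mul_of_nonpos_left this (by linarith)
    _ ≤ ∑ i, σ i * (inner ℝ (e i) z ^ 2 - inner ℝ (f i) z ^ 2) := by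
        rw [mul_sum]
        refine sum_le_sum fun i _ => ?_
        have h1 := mul_nonneg (hσ0 i) (sq_nonneg (inner ℝ (e i) z))
        by_cases hi : i ∈ B
        · rw [hzf i hi]
          linarith
        · have := mul_le_mul_of_nonneg_right (hρ i hi) (sq_nonneg (inner ℝ (f i) z))
          linarith
    _ ≤ ∑ i, γ i * inner ℝ (b i) z ^ 2 := hform z
    _ ≤ γ r * ‖z‖ ^ 2 := by
        rw [← b.sum_sq_inner_right, mul_sum]
        refine sum_le_sum fun i _ => ?_
        by_cases hi : i ∈ Ici r
        · exact mul_le_mul_of_nonneg_right (hγ (mem_Ici.1 hi)) (sq_nonneg _)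
        · simp [hbz i hi]

end Weyl

theorem sum_abs_sub_le_of_form_eq {V ι : Type*} [NormedAddCommGroup V] [InnerProductSpace ℝ V]
    [FiniteDimensional ℝ V] [Fintype ι] {n N : ℕ} (hN : Module.finrank ℝ V = N) (hn : 2 * n ≤ N)
    {e f e' f' : Fin n → V} {σ τ : Fin n → ℝ} {g h : ι → V} {d : ι → ℝ}
    (he : Orthonormal ℝ e) (hf : Orthonormal ℝ f) (hef : ∀ i j, inner ℝ (e i) (f j) = 0)
    (he' : Orthonormal ℝ e') (hf' : Orthonormal ℝ f') (hef' : ∀ i j, inner ℝ (e' i) (f' j) = 0)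
    (hσ : Antitone σ) (hσ0 : ∀ i, 0 ≤ σ i) (hτ : Antitone τ) (hτ0 : ∀ i, 0 ≤ τ i)
    (hd : ∀ i, 0 ≤ d i) (hh : ∀ i, ‖h i‖ = 1)
    (hform : ∀ z, ∑ i, σ i * (inner ℝ (e i) z ^ 2 - inner ℝ (f i) z ^ 2) -
      ∑ i, τ i * (inner ℝ (e' i) z ^ 2 - inner ℝ (f' i) z ^ 2) =
      ∑ i, d i * (inner ℝ (g i) z ^ 2 - inner ℝ (h i) z ^ 2)) :
    ∑ i, |σ i - τ i| ≤ ∑ i, d i := by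
  obtain ⟨b, γ, hγ, hb, htr⟩ := exists_sorted_diagonalization hN
    (Sum.elim σ (Sum.elim (fun i => -σ i) d)) (Sum.elim e (Sum.elim f h))
  simp only [Fintype.sum_sum_type, Sum.elim_inl, Sum.elim_inr, he.1, hf.1, hh, one_pow, mul_one]
    at hb htr
  have hdsum : ∑ i, γ i = ∑ i, d i := by
    rw [htr, sum_neg_distrib]; ring
  have hC : ∀ z, ∑ i, γ i * inner ℝ (b i) z ^ 2 =
      ∑ i, σ i * (inner ℝ (e i) z ^ 2 - inner ℝ (f i) z ^ 2) + ∑ i, d i * inner ℝ (h i) z ^ 2 := by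
    intro z
    rw [← hb z]
    simp only [mul_sub, sum_sub_distrib, neg_mul, sum_neg_distrib]
    ring
  have hX : ∀ z, ∑ i, σ i * (inner ℝ (e i) z ^ 2 - inner ℝ (f i) z ^ 2) ≤
      ∑ i, γ i * inner ℝ (b i) z ^ 2 := by
    intro z
    have := sum_nonneg fun i (_ : i ∈ univ) => mul_nonneg (hd i) (sq_nonneg (inner ℝ (h i) z))
    linarith [hC z]
  have hY : ∀ z, ∑ i, τ i * (inner ℝ (e' i) z ^ 2 - inner ℝ (f' i) z ^ 2) ≤
      ∑ i, γ i * inner ℝ (b i) z ^ 2 := by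
    intro z
    have h1 := sum_nonneg fun i (_ : i ∈ univ) => mul_nonneg (hd i) (sq_nonneg (inner ℝ (g i) z))
    have h2 := hform z
    simp only [mul_sub, sum_sub_distrib] at h2
    have h3 := hC z
    simp only [mul_sub, sum_sub_distrib] at h3 ⊢
    linarith
  have key : ∀ j : Fin n, |σ j - τ j| ≤
      γ ⟨j, by omega⟩ + γ ⟨N - 1 - j, by omega⟩ := by
    intro j
    have a1 := le_sorted_eigenvalue he hef hσ hγ hX j ⟨j, by omega⟩ rfl
    have a2 := le_sorted_eigenvalue he' hef' hτ hγ hY j ⟨j, by omega⟩ rfl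
    have a3 := neg_le_sorted_eigenvalue hf hσ0 hγ hX (Iio j) ⟨N - 1 - j, by omega⟩
      (by simp; omega) (σ j) (hσ0 j) (fun i hi => hσ (by simpa using hi))
    have a4 := neg_le_sorted_eigenvalue hf' hτ0 hγ hY (Iio j) ⟨N - 1 - j, by omega⟩
      (by simp; omega) (τ j) (hτ0 j) (fun i hi => hτ (by simpa using hi))
    rw [abs_le]
    constructor <;> linarith
  have hmid : ∀ i : Fin N, (i : ℕ) + n < N → 0 ≤ γ i := by
    intro i hi
    have := neg_le_sorted_eigenvalue hf hσ0 hγ hX univ i (by simp; omega) 0 le_rfl (by simp)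
    linarith
  rw [← hdsum]
  refine (sum_le_sum fun j _ => key j).trans ?_
  rw [sum_add_distrib]
  let φ : Fin n → Fin N := fun j => ⟨j, by omega⟩
  let ψ : Fin n → Fin N := fun j => ⟨N - 1 - j, by omega⟩
  have hφv : ∀ j, (φ j : ℕ) = j := fun _ => rfl
  have hψv : ∀ j, (ψ j : ℕ) = N - 1 - j := fun _ => rfl
  have hφ : Set.InjOn φ (univ : Finset (Fin n)) := fun a _ b _ h => by
    have h' := congrArg Fin.val h
    rw [hφv, hφv] at h'
    exact Fin.ext h'
  have hψ : Set.InjOn ψ (univ : Finset (Fin n)) := fun a _ b _ h => by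
    have h' := congrArg Fin.val h
    rw [hψv, hψv] at h'
    exact Fin.ext (by omega)
  have hdisj : Disjoint (univ.image φ) (univ.image ψ) := by
    rw [disjoint_left]
    intro i hi hi'
    simp only [mem_image, mem_univ, true_and] at hi hi'
    obtain ⟨a, rfl⟩ := hi
    obtain ⟨c, hc⟩ := hi'
    have h' := congrArg Fin.val hc
    rw [hφv, hψv] at h'
    omega
  change ∑ j, γ (φ j) + ∑ j, γ (ψ j) ≤ _
  rw [← sum_image hφ, ← sum_image hψ, ← sum_union hdisj]
  refine sum_le_sum_of_subset_of_nonneg (subset_univ _) fun i _ hi => hmid i ?_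
  by_contra hcon
  refine hi (mem_union_right _ (mem_image.2 ⟨⟨N - 1 - i, by omega⟩, mem_univ _, Fin.ext ?_⟩))
  rw [hψv]
  simp only
  omega

/-- `M = ∑ σ i • u i (v i)ᵀ` with `σ` nonnegative and `u`, `v` orthonormal families; the singular
values are not required to be sorted. -/
structure IsSVD {n₁ n₂ : ℕ} (M : Matrix (Fin n₁) (Fin n₂) ℝ) (σ : Fin n₁ → ℝ)
    (u : Fin n₁ → Fin n₁ → ℝ) (v : Fin n₁ → Fin n₂ → ℝ) : Prop where
  nonneg : ∀ i, 0 ≤ σ i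
  left : ∀ i j, ∑ a, u i a * u j a = if i = j then (1 : ℝ) else 0
  right : ∀ i j, ∑ b, v i b * v j b = if i = j then (1 : ℝ) else 0
  eq_sum : M = ∑ i, rank1 (σ i) (u i) (v i)

section SVD

variable {n₁ n₂ : ℕ}

theorem IsSVD.comp_perm {M : Matrix (Fin n₁) (Fin n₂) ℝ} {σ : Fin n₁ → ℝ}
    {u : Fin n₁ → Fin n₁ → ℝ} {v : Fin n₁ → Fin n₂ → ℝ} (h : IsSVD M σ u v)
    (π : Equiv.Perm (Fin n₁)) : IsSVD M (σ ∘ π) (u ∘ π) (v ∘ π) where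
  nonneg i := h.nonneg _
  left i j := by simp [h.left]
  right i j := by simp [h.right]
  eq_sum := by
    rw [h.eq_sum]
    exact (Equiv.sum_comp π fun i => rank1 (σ i) (u i) (v i)).symm

theorem exists_isSVD_nucNorm (hn : n₁ ≤ n₂) (M : Matrix (Fin n₁) (Fin n₂) ℝ) :
    ∃ σ u v, IsSVD M σ u v ∧ Antitone σ ∧ ∑ i, σ i = nucNorm M := by
  set hM := Matrix.isHermitian_mul_conjTranspose_self M with hMdef
  set ev := hM.eigenvalues with hev
  have hev0 : ∀ i, 0 ≤ ev i := (Matrix.posSemidef_self_mul_conjTranspose M).eigenvalues_nonneg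
  set w := hM.eigenvectorBasis with hw
  have hwo : ∀ i j, ∑ a, w i a * w j a = if i = j then (1 : ℝ) else 0 := by
    intro i j
    have := orthonormal_iff_ite.1 w.orthonormal i j
    rw [← this]
    simp [PiLp.inner_apply, mul_comm]
  set y : Fin n₁ → Fin n₂ → ℝ := fun i b => ∑ a, w i a * M a b with hy
  have hyo : ∀ i j, ∑ b, y i b * y j b = if i = j then ev i else 0 := by
    intro i j
    have h1 : ∀ a, ∑ b, M a b * y j b = ev j * w j a := by
      intro a
      have := congrFun (hM.mulVec_eigenvectorBasis j) a
      simp only [← Matrix.mulVec_mulVec, Pi.smul_apply, smul_eq_mul] at this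
      rw [← this]
      simp only [Matrix.mulVec, dotProduct, Matrix.conjTranspose_apply, star_trivial, hy]
      refine sum_congr rfl fun b _ => ?_
      congr 1
      exact sum_congr rfl fun a _ => mul_comm _ _
    calc ∑ b, y i b * y j b = ∑ a, w i a * ∑ b, M a b * y j b := by
          simp only [mul_sum]
          rw [sum_comm]
          refine sum_congr rfl fun b _ => ?_
          simp only [hy, sum_mul, mul_assoc]
      _ = ev j * ∑ a, w i a * w j a := by
          simp only [h1, mul_sum]
          exact sum_congr rfl fun a _ => by ring
      _ = _ := by
          rw [hwo]
          split_ifs with h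
          · rw [h, mul_one]
          · rw [mul_zero]
  have hMw : ∀ a b, M a b = ∑ i, w i a * y i b := by
    intro a b
    have := w.sum_repr' (WithLp.toLp 2 fun a => M a b)
    have := congrArg (fun z : EuclideanSpace ℝ (Fin n₁) => z a) this
    simp only [WithLp.ofLp_sum, Finset.sum_apply, PiLp.smul_apply, smul_eq_mul] at this
    rw [← this]
    refine sum_congr rfl fun i _ => ?_
    rw [mul_comm]
    congr 1
    simp [PiLp.inner_apply, hy, mul_comm]
  set S : Set (Fin n₂) := {l | ∃ i : Fin n₁, Fin.castLE hn i = l ∧ ev i ≠ 0} with hS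
  let Y : Fin n₂ → EuclideanSpace ℝ (Fin n₂) := fun l =>
    if h : (l : ℕ) < n₁ then (√(ev ⟨l, h⟩))⁻¹ • WithLp.toLp 2 (y ⟨l, h⟩) else 0
  have hYcast : ∀ i, Y (Fin.castLE hn i) = (√(ev i))⁻¹ • WithLp.toLp 2 (y i) := by
    intro i
    simp [Y]
  have hYo : Orthonormal ℝ (S.domRestrict Y) := by
    rw [orthonormal_iff_ite]
    rintro ⟨_, i, rfl, hi⟩ ⟨_, j, rfl, hj⟩
    simp only [Set.domRestrict_apply, hYcast, Subtype.mk.injEq]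
    rw [real_inner_smul_left, real_inner_smul_right]
    have : inner ℝ (WithLp.toLp 2 (y i)) (WithLp.toLp 2 (y j)) = if i = j then ev i else 0 := by
      rw [← hyo]
      simp [PiLp.inner_apply, mul_comm]
    rw [this]
    by_cases hij : i = j
    · subst hij
      have h1 := Real.mul_self_sqrt (hev0 i)
      have h2 : √(ev i) ≠ 0 := fun h => hi (by rw [← h1, h, mul_zero])
      simp only [if_true]
      field_simp
      rw [pow_two, h1]
    · rw [if_neg hij, if_neg fun h => hij (Fin.castLE_injective hn h)]
      simp
  obtain ⟨B, hB⟩ := hYo.exists_orthonormalBasis_extension_of_card_eq (by simp)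
  have hsvd : IsSVD M (fun i => √(ev i)) (fun i a => w i a) (fun i b => B (Fin.castLE hn i) b) := by
    refine ⟨fun i => Real.sqrt_nonneg _, hwo, ?_, ?_⟩
    · intro i j
      have := orthonormal_iff_ite.1 B.orthonormal (Fin.castLE hn i) (Fin.castLE hn j)
      simp only [(Fin.castLE_injective hn).eq_iff] at this
      rw [← this]
      simp [PiLp.inner_apply, mul_comm]
    · ext a b
      rw [hMw, Matrix.sum_apply]
      refine sum_congr rfl fun i _ => ?_
      simp only [rank1, Matrix.of_apply]
      by_cases hi : ev i = 0
      · have h0 : y i b = 0 := by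
          have := hyo i i
          rw [if_pos rfl, hi, sum_eq_zero_iff_of_nonneg fun b _ => mul_self_nonneg _] at this
          exact mul_self_eq_zero.1 (this b (mem_univ _))
        simp [h0, hi]
      · rw [hB _ ⟨i, rfl, hi⟩, hYcast]
        have h2 : √(ev i) ≠ 0 := fun h => hi (by rw [← Real.mul_self_sqrt (hev0 i), h, mul_zero])
        simp only [PiLp.smul_apply, smul_eq_mul]
        field_simp
  refine ⟨_, _, _, hsvd.comp_perm (Tuple.sort fun i => -√(ev i)), ?_, ?_⟩
  · intro i j hij
    have := Tuple.monotone_sort (fun i => -√(ev i)) hij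
    simp only [Function.comp_apply] at this ⊢
    linarith
  · exact Equiv.sum_comp (Tuple.sort fun i => -√(ev i)) fun i => √(ev i)

/-- The vector `(x, ε y) / √2`. For singular vectors `x`, `y` and `ε = ±1` it is an eigenvector of
the Hermitian dilation. -/
noncomputable def dilationVec (ε : ℝ) (x : Fin n₁ → ℝ) (y : Fin n₂ → ℝ) :
    EuclideanSpace ℝ (Fin n₁ ⊕ Fin n₂) :=
  WithLp.toLp 2 (Sum.elim (fun a => (√2)⁻¹ * x a) fun b => (√2)⁻¹ * (ε * y b))

theorem inner_dilationVec (ε : ℝ) (x : Fin n₁ → ℝ) (y : Fin n₂ → ℝ)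
    (z : EuclideanSpace ℝ (Fin n₁ ⊕ Fin n₂)) :
    inner ℝ (dilationVec ε x y) z =
      (√2)⁻¹ * (∑ a, x a * z (Sum.inl a) + ε * ∑ b, y b * z (Sum.inr b)) := by
  simp only [PiLp.inner_apply, dilationVec, Fintype.sum_sum_type, Sum.elim_inl, Sum.elim_inr,
    mul_add, mul_sum, RCLike.inner_apply, conj_trivial]
  congr 1 <;> exact sum_congr rfl fun _ _ => by ring

theorem inner_dilationVec_dilationVec (ε ε' : ℝ) (x x' : Fin n₁ → ℝ) (y y' : Fin n₂ → ℝ) :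
    inner ℝ (dilationVec ε x y) (dilationVec ε' x' y') =
      (∑ a, x a * x' a + ε * ε' * ∑ b, y b * y' b) / 2 := by
  have h2 : (√2)⁻¹ * (√2)⁻¹ = (1 / 2 : ℝ) := by
    rw [← mul_inv, Real.mul_self_sqrt zero_le_two, one_div]
  rw [inner_dilationVec]
  simp only [dilationVec, Sum.elim_inl, Sum.elim_inr]
  have e1 : ∑ a, x a * ((√2)⁻¹ * x' a) = (√2)⁻¹ * ∑ a, x a * x' a := by
    rw [mul_sum]; exact sum_congr rfl fun _ _ => by ring
  have e2 : ∑ b, y b * ((√2)⁻¹ * (ε' * y' b)) = (√2)⁻¹ * (ε' * ∑ b, y b * y' b) := by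
    simp only [mul_sum]; exact sum_congr rfl fun _ _ => by ring
  rw [e1, e2]
  linear_combination (∑ a, x a * x' a + ε * ε' * ∑ b, y b * y' b) * h2

variable {M M' D : Matrix (Fin n₁) (Fin n₂) ℝ} {σ τ d : Fin n₁ → ℝ}
  {u p g : Fin n₁ → Fin n₁ → ℝ} {v q h : Fin n₁ → Fin n₂ → ℝ}

theorem IsSVD.orthonormal_dilationVec (hM : IsSVD M σ u v) {ε : ℝ} (hε : ε * ε = 1) :
    Orthonormal ℝ fun i => dilationVec ε (u i) (v i) := by
  rw [orthonormal_iff_ite]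
  intro i j
  rw [inner_dilationVec_dilationVec, hM.left, hM.right, hε]
  split_ifs <;> norm_num

theorem IsSVD.inner_dilationVec_neg (hM : IsSVD M σ u v) (i j : Fin n₁) :
    inner ℝ (dilationVec 1 (u i) (v i)) (dilationVec (-1) (u j) (v j)) = 0 := by
  rw [inner_dilationVec_dilationVec, hM.left, hM.right]
  split_ifs <;> norm_num

theorem IsSVD.dilation_form (hM : IsSVD M σ u v) (z : EuclideanSpace ℝ (Fin n₁ ⊕ Fin n₂)) :
    ∑ i, σ i * (inner ℝ (dilationVec 1 (u i) (v i)) z ^ 2 -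
      inner ℝ (dilationVec (-1) (u i) (v i)) z ^ 2) =
      2 * ∑ a, ∑ b, z (Sum.inl a) * M a b * z (Sum.inr b) := by
  have h2 : (√2)⁻¹ * (√2)⁻¹ = (1 / 2 : ℝ) := by
    rw [← mul_inv, Real.mul_self_sqrt zero_le_two, one_div]
  have e1 : ∀ a b, z (Sum.inl a) * M a b * z (Sum.inr b) =
      ∑ i, σ i * ((u i a * z (Sum.inl a)) * (v i b * z (Sum.inr b))) := by
    intro a b
    rw [hM.eq_sum, Matrix.sum_apply, mul_sum, sum_mul]
    refine sum_congr rfl fun i _ => ?_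
    simp only [rank1, Matrix.of_apply]
    ring
  have e2 : ∑ a, ∑ b, z (Sum.inl a) * M a b * z (Sum.inr b) =
      ∑ i, σ i * ((∑ a, u i a * z (Sum.inl a)) * ∑ b, v i b * z (Sum.inr b)) := by
    simp only [e1]
    calc _ = ∑ a, ∑ i, ∑ b, σ i * ((u i a * z (Sum.inl a)) * (v i b * z (Sum.inr b))) :=
          sum_congr rfl fun a _ => sum_comm
      _ = _ := by
          rw [sum_comm]
          refine sum_congr rfl fun i _ => ?_
          rw [sum_mul_sum]
          simp only [mul_sum]
  rw [e2, mul_sum]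
  refine sum_congr rfl fun i _ => ?_
  rw [inner_dilationVec, inner_dilationVec]
  linear_combination 4 * σ i * (∑ a, u i a * z (Sum.inl a)) *
    (∑ b, v i b * z (Sum.inr b)) * h2

/-- **Mirsky's inequality** for the nuclear norm. -/
theorem IsSVD.sum_abs_sub_le (hn : n₁ ≤ n₂) (hM : IsSVD M σ u v) (hM' : IsSVD M' τ p q)
    (hD : IsSVD D d g h) (hσ : Antitone σ) (hτ : Antitone τ) (hMD : M - M' = D) :
    ∑ i, |σ i - τ i| ≤ ∑ i, d i := by
  have hneg : -1 * -1 = (1 : ℝ) := by norm_num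
  refine sum_abs_sub_le_of_form_eq (V := EuclideanSpace ℝ (Fin n₁ ⊕ Fin n₂)) rfl
    (by simp; omega)
    (hM.orthonormal_dilationVec (one_mul 1)) (hM.orthonormal_dilationVec hneg)
    hM.inner_dilationVec_neg
    (hM'.orthonormal_dilationVec (one_mul 1)) (hM'.orthonormal_dilationVec hneg)
    hM'.inner_dilationVec_neg hσ hM.nonneg hτ hM'.nonneg hD.nonneg
    (hD.orthonormal_dilationVec hneg).1
    (g := fun i => dilationVec 1 (g i) (h i)) ?_
  intro z
  rw [hM.dilation_form, hM'.dilation_form, hD.dilation_form, ← hMD]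
  simp only [Matrix.sub_apply, mul_sub, sub_mul, sum_sub_distrib]

theorem IsSVD.nucNorm_eq (hn : n₁ ≤ n₂) (hM : IsSVD M σ u v) (hσ : Antitone σ) :
    nucNorm M = ∑ i, σ i := by
  obtain ⟨s, p, q, hs, hsanti, hsum⟩ := exists_isSVD_nucNorm hn M
  have h0 : IsSVD (0 : Matrix (Fin n₁) (Fin n₂) ℝ) 0 u v :=
    ⟨fun _ => le_rfl, hM.left, hM.right, by ext a b; simp [rank1, Matrix.sum_apply]⟩
  have h1 := hM.sum_abs_sub_le hn h0 hs hσ antitone_const (sub_zero M)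
  have h2 := hs.sum_abs_sub_le hn h0 hM hsanti antitone_const (sub_zero M)
  simp only [Pi.zero_apply, sub_zero, abs_of_nonneg (hM.nonneg _), abs_of_nonneg (hs.nonneg _)]
    at h1 h2
  linarith

theorem frobNorm_sq_eq_sum (M : Matrix (Fin n₁) (Fin n₂) ℝ) :
    frobNorm M ^ 2 = ∑ a, ∑ b, M a b ^ 2 :=
  Real.sq_sqrt (sum_nonneg fun _ _ => sum_nonneg fun _ _ => sq_nonneg _)

theorem IsSVD.frobNorm_sq (hM : IsSVD M σ u v) (c : Fin n₁ → ℝ) :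
    frobNorm (∑ i, rank1 (c i) (u i) (v i)) ^ 2 = ∑ i, c i ^ 2 := by
  rw [frobNorm_sq_eq_sum]
  have e1 : ∀ a b, (∑ i, rank1 (c i) (u i) (v i)) a b ^ 2 =
      ∑ i, ∑ j, c i * c j * ((u i a * u j a) * (v i b * v j b)) := by
    intro a b
    rw [Matrix.sum_apply, pow_two, sum_mul_sum]
    refine sum_congr rfl fun i _ => sum_congr rfl fun j _ => ?_
    simp only [rank1, Matrix.of_apply]
    ring
  calc _ = ∑ a, ∑ i, ∑ j, ∑ b, c i * c j * ((u i a * u j a) * (v i b * v j b)) := by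
        refine sum_congr rfl fun a _ => ?_
        simp only [e1]
        rw [sum_comm]
        exact sum_congr rfl fun i _ => sum_comm
    _ = ∑ i, ∑ j, c i * c j * ((∑ a, u i a * u j a) * ∑ b, v i b * v j b) := by
        rw [sum_comm]
        refine sum_congr rfl fun i _ => ?_
        rw [sum_comm]
        refine sum_congr rfl fun j _ => ?_
        rw [sum_mul_sum]
        simp only [mul_sum]
    _ = _ := by
        simp only [hM.left, hM.right]
        simp [pow_two]

theorem rank_sum_rank1_le_s1 (c : Fin n₁ → ℝ) (u : Fin n₁ → Fin n₁ → ℝ) (v : Fin n₁ → Fin n₂ → ℝ)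
    (I : Finset (Fin n₁)) (hc : ∀ i ∉ I, c i = 0) :
    (∑ i, rank1 (c i) (u i) (v i)).rank ≤ I.card := by
  have : ∑ i, rank1 (c i) (u i) (v i) =
      (Matrix.of fun a (i : I) => c i * u i a) * Matrix.of fun (i : I) b => v i b := by
    ext a b
    rw [Matrix.sum_apply, Matrix.mul_apply, ← sum_subset (subset_univ I), ← sum_coe_sort I]
    · rfl
    · intro i _ hi
      simp [rank1, hc i hi]
  rw [this]
  refine (Matrix.rank_mul_le_left _ _).trans ((Matrix.rank_le_card_width _).trans ?_)
  simp

end SVD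

theorem le_add_of_sq_le_mul_add_sq {x B D : ℝ} (hB : 0 ≤ B) (hD : 0 ≤ D)
    (h : x ^ 2 ≤ B * x + D ^ 2) : x ≤ B + D := by
  by_contra! hx
  nlinarith [mul_pos (by linarith : 0 < x - (B + D)) (by linarith : 0 < x)]

theorem le_of_residual_bounds {r β₁ β₂ e l a T S x : ℝ} (hr : 0 < r) (hr1 : 1 ≤ r) (hβ₁ : 0 < β₁)
    (hβ₂ : 0 < β₂) (hβ₂' : β₂ < 1) (he : 0 ≤ e) (hl : 0 < l) (hS : 0 ≤ S)
    (hx : x ≤ β₁ * a + β₂ * T / r)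
    (h : a ^ 2 - 2 * (r * β₁ * l + e) * a + 2 * l * (1 - β₂) * T ≤ 4 * l * S) (hT : 0 ≤ T) :
    x + T ≤ (2 * r * β₁ * (2 * r + 1 + β₂) * l + 2 * (r * β₂ + 2 * β₂ + r) * e) /
        (r ^ 2 * β₁ * (1 - β₂) * l) * S +
      (2 * (r ^ 2 + r) * β₁ * l + (β₂ + 2 * r - r * β₂) * e) * (r * β₁ * l + e) /
        (r * (1 - β₂) * l) := by
  set c := r * β₁ * l + e with hc
  have hrb : 0 < r * β₁ * l := by positivity
  have hc0 : 0 < c := by linarith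
  have h1 : 0 < 1 - β₂ := by linarith
  obtain ⟨P, hP⟩ : ∃ P, S = c * P := ⟨S / c, by field_simp⟩
  have hP0 : 0 ≤ P := by
    by_contra! hneg
    nlinarith
  have hTl : 0 ≤ 2 * l * (1 - β₂) * T := by positivity
  have ha : a ≤ 2 * c + 2 * l * P := by
    by_contra! hlt
    have hlP : 0 ≤ l * P := by positivity
    nlinarith [mul_pos (by linarith : 0 < a - (2 * c + 2 * l * P)) (by linarith : 0 < a)]
  have hT' : T ≤ (4 * l * S + c ^ 2) / (2 * l * (1 - β₂)) := by
    rw [le_div_iff₀ (by positivity)]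
    nlinarith [sq_nonneg (a - c)]
  have hPS : β₁ * (2 * l * P) ≤ 2 / r * S := by
    rw [div_mul_eq_mul_div, le_div_iff₀ hr, hP]
    nlinarith [mul_nonneg he hP0]
  have hC₃ : 2 / r + (β₂ / r + 1) * (2 / (1 - β₂)) ≤
      (2 * r * β₁ * (2 * r + 1 + β₂) * l + 2 * (r * β₂ + 2 * β₂ + r) * e) /
        (r ^ 2 * β₁ * (1 - β₂) * l) := by
    rw [le_div_iff₀ (by positivity)]
    have : (2 / r + (β₂ / r + 1) * (2 / (1 - β₂))) * (r ^ 2 * β₁ * (1 - β₂) * l) =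
        2 * r * β₁ * (r + 1) * l := by
      field_simp
      ring
    rw [this]
    have h2 : 0 ≤ 2 * (r * β₂ + 2 * β₂ + r) * e := by positivity
    have h3 : 0 ≤ (r * β₁ * l) * (r + β₂) := by positivity
    nlinarith
  have hC₄ : β₁ * (2 * c) + (β₂ / r + 1) * (c ^ 2 / (2 * l * (1 - β₂))) ≤
      (2 * (r ^ 2 + r) * β₁ * l + (β₂ + 2 * r - r * β₂) * e) * c / (r * (1 - β₂) * l) := by
    rw [le_div_iff₀ (by positivity)]
    have : (β₁ * (2 * c) + (β₂ / r + 1) * (c ^ 2 / (2 * l * (1 - β₂)))) * (r * (1 - β₂) * l) =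
        (2 * β₁ * r * l * (1 - β₂) + (β₂ + r) * c / 2) * c := by
      field_simp
    rw [this]
    refine mul_le_mul_of_nonneg_right ?_ hc0.le
    rw [hc]
    have h2 : 0 ≤ (r * β₁ * l) * β₂ := by positivity
    have h3 : 0 ≤ (r * β₁ * l) * (1 - β₂) := by positivity
    have h4 : 0 ≤ r * e * (1 - β₂) := by positivity
    have h5 : 0 ≤ (r * β₁ * l) * (r - 1) := mul_nonneg hrb.le (by linarith)
    nlinarith [mul_nonneg hβ₂.le he, mul_nonneg hr.le he]
  have hxT : x + T ≤ β₁ * a + (β₂ / r + 1) * T := by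
    have : β₂ * T / r = β₂ / r * T := by ring
    linarith
  have hTe : (4 * l * S + c ^ 2) / (2 * l * (1 - β₂)) =
      2 / (1 - β₂) * S + c ^ 2 / (2 * l * (1 - β₂)) := by
    field_simp
    ring
  rw [hTe] at hT'
  have := mul_le_mul_of_nonneg_left hT' (by positivity : 0 ≤ β₂ / r + 1)
  have := mul_le_mul_of_nonneg_left ha hβ₁.le
  have := mul_le_mul_of_nonneg_right hC₃ hS
  linarith

theorem rank1_eq_smul {n₁ n₂ : ℕ} (s : ℝ) (u : Fin n₁ → ℝ) (v : Fin n₂ → ℝ) :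
    rank1 s u v = s • rank1 1 u v := by
  ext a b
  simp [rank1, mul_assoc]

theorem IsSVD.neg {n₁ n₂ : ℕ} {M : Matrix (Fin n₁) (Fin n₂) ℝ} {σ : Fin n₁ → ℝ}
    {u : Fin n₁ → Fin n₁ → ℝ} {v : Fin n₁ → Fin n₂ → ℝ} (h : IsSVD M σ u v) :
    IsSVD (-M) σ (-u) v where
  nonneg := h.nonneg
  left i j := by simpa using h.left i j
  right := h.right
  eq_sum := by
    rw [h.eq_sum, ← sum_neg_distrib]
    refine sum_congr rfl fun i _ => ?_
    ext a b
    simp [rank1]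

/-- Consequence of the restricted isometry property for a matrix with singular values `τ`. -/
theorem HasRIP.exists_bound {n₁ n₂ m k s : ℕ}
    {A : Matrix (Fin n₁) (Fin n₂) ℝ →ₗ[ℝ] EuclideanSpace ℝ (Fin m)} {δ : ℝ} (hδ0 : 0 < δ)
    (hs : 0 < s) (hRIP : HasRIP A (k + s) δ) {H : Matrix (Fin n₁) (Fin n₂) ℝ} {τ : Fin n₁ → ℝ}
    {p : Fin n₁ → Fin n₁ → ℝ} {q : Fin n₁ → Fin n₂ → ℝ} (hH : IsSVD H τ p q)
    (K : Finset (Fin n₁)) (hK : K.card ≤ k) :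
    ∃ x, 0 ≤ x ∧ ∑ i ∈ K, τ i ^ 2 ≤ x ^ 2 ∧ frobNorm H ^ 2 ≤ x ^ 2 + (∑ i ∈ Kᶜ, τ i) ^ 2 ∧
      (1 - δ ^ 2) * x ^ 2 ≤
        2 * (√(1 + δ) * x * ‖A H‖) + δ ^ 2 * ((∑ i ∈ Kᶜ, τ i) ^ 2 / s) := by
  have hA : ∀ c : Fin n₁ → ℝ, ∑ i, c i • A (rank1 1 (p i) (q i)) =
      A (∑ i, rank1 (c i) (p i) (q i)) := by
    intro c
    simp only [map_sum, ← map_smul, ← rank1_eq_smul]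
  obtain ⟨x, hx0, hx1, hx2, hx3⟩ := sparse_null_space_bound
    (fun i => A (rank1 1 (p i) (q i))) k s δ hδ0 hs
    (fun c I hI hc => by
      rw [hA, ← hH.frobNorm_sq c]
      exact hRIP _ ((rank_sum_rank1_le_s1 c p q I hc).trans hI)) τ hH.nonneg K hK
  rw [hA, ← hH.eq_sum] at hx3
  rw [← hH.frobNorm_sq τ, ← hH.eq_sum] at hx2
  exact ⟨x, hx0, hx1, hx2, hx3⟩

theorem le_of_robust_null_space_bound {t δ k r β₁ β₂ a T N x : ℝ} (ht : 1 < t) (hδ0 : 0 < δ)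
    (hδ1 : δ < 1) (hk0 : 0 < k) (hr2 : r ^ 2 = k) (hr0 : 0 < r)
    (hβ₁ : β₁ = 2 / ((1 - δ) * √(1 + δ))) (hβ₂ : β₂ = δ / √((1 - δ ^ 2) * (t - 1)))
    (ha0 : 0 ≤ a) (hT0 : 0 ≤ T) (hN : (t - 1) * k ≤ N)
    (hx : (1 - δ ^ 2) * x ^ 2 ≤ 2 * (√(1 + δ) * x * a) + δ ^ 2 * (T ^ 2 / N)) :
    x ≤ β₁ * a + β₂ * T / r := by
  have hδsq : 0 < 1 - δ ^ 2 := by nlinarith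
  have hdt : 0 < (1 - δ ^ 2) * (t - 1) := mul_pos hδsq (by linarith)
  have h1δ : 0 < 1 - δ := by linarith
  have hsδ : 0 < √(1 + δ) := Real.sqrt_pos.2 (by linarith)
  have hβ₁0 : 0 ≤ β₁ := by rw [hβ₁]; positivity
  have hβ₂0 : 0 ≤ β₂ := by rw [hβ₂]; positivity
  refine le_add_of_sq_le_mul_add_sq (by positivity) (by positivity) ?_
  have hsq : √(1 + δ) ^ 2 = 1 + δ := Real.sq_sqrt (by linarith)
  have h1 : (1 - δ ^ 2) * β₁ = 2 * √(1 + δ) := by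
    rw [hβ₁, mul_div_assoc', div_eq_iff (by positivity)]
    linear_combination -2 * (1 - δ) * hsq
  have h2 : (1 - δ ^ 2) * (β₂ * T / r) ^ 2 = δ ^ 2 * (T ^ 2 / ((t - 1) * k)) := by
    have : t - 1 ≠ 0 := by linarith
    rw [div_pow, mul_pow, hr2, hβ₂, div_pow, Real.sq_sqrt hdt.le]
    field_simp
  have h3 : T ^ 2 / N ≤ T ^ 2 / ((t - 1) * k) :=
    div_le_div_of_nonneg_left (sq_nonneg T) (mul_pos (by linarith) hk0) hN
  have h4 := mul_le_mul_of_nonneg_left h3 (sq_nonneg δ)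
  refine le_of_mul_le_mul_left ?_ hδsq
  rw [mul_add, h2, ← mul_assoc, ← mul_assoc, h1]
  linarith

theorem sq_residual_le_of_le {n₁ n₂ m : ℕ}
    (A : Matrix (Fin n₁) (Fin n₂) ℝ →ₗ[ℝ] EuclideanSpace ℝ (Fin m))
    {X Xs : Matrix (Fin n₁) (Fin n₂) ℝ} {nv b : EuclideanSpace ℝ (Fin m)} {ε lam : ℝ}
    (hlam : 0 < lam) (hnv : ‖nv‖ ≤ ε) (hb : b = A X + nv)
    (h : nucNorm Xs + (1 / (2 * lam)) * ‖b - A Xs‖ ^ 2 ≤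
      nucNorm X + (1 / (2 * lam)) * ‖b - A X‖ ^ 2) :
    ‖A (Xs - X)‖ ^ 2 - 2 * ε * ‖A (Xs - X)‖ ≤ 2 * lam * (nucNorm X - nucNorm Xs) := by
  have h2 : b - A X = nv := by rw [hb]; abel
  have h3 : b - A Xs = nv - A (Xs - X) := by rw [hb, map_sub]; abel
  rw [h2, h3, norm_sub_sq_real] at h
  have h4 : inner ℝ nv (A (Xs - X)) ≤ ε * ‖A (Xs - X)‖ :=
    (real_inner_le_norm _ _).trans (mul_le_mul_of_nonneg_right hnv (norm_nonneg _))
  have h5 := mul_le_mul_of_nonneg_left h (by positivity : 0 ≤ 2 * lam)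
  have h6 : ∀ y z : ℝ, 2 * lam * (y + 1 / (2 * lam) * z) = 2 * lam * y + z := by
    intro y z
    field_simp
  rw [h6, h6] at h5
  linarith

theorem stmt1 {n₁ n₂ m k : ℕ} (hk : 0 < k) (hn : n₁ ≤ n₂)
    (A : Matrix (Fin n₁) (Fin n₂) ℝ →ₗ[ℝ] EuclideanSpace ℝ (Fin m))
    (t δ : ℝ) (ht : 1 < t) (hδ0 : 0 < δ)
    (hδ : δ < Real.sqrt ((t - 1) / t))
    (hRIP : HasRIP A ⌈t * (k : ℝ)⌉₊ δ)
    (X : Matrix (Fin n₁) (Fin n₂) ℝ)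
    -- SVD of `X`, with singular values `σ` in decreasing order
    (σ : Fin n₁ → ℝ) (u : Fin n₁ → Fin n₁ → ℝ) (v : Fin n₁ → Fin n₂ → ℝ)
    (hσ0 : ∀ i, 0 ≤ σ i) (hσmono : ∀ i j : Fin n₁, i ≤ j → σ j ≤ σ i)
    (hu : ∀ i j, ∑ a, u i a * u j a = if i = j then (1 : ℝ) else 0)
    (hv : ∀ i j, ∑ b, v i b * v j b = if i = j then (1 : ℝ) else 0)
    (hX : X = ∑ i, rank1 (σ i) (u i) (v i))
    (nv : EuclideanSpace ℝ (Fin m)) (ε : ℝ) (hnv : ‖nv‖ ≤ ε)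
    (b : EuclideanSpace ℝ (Fin m)) (hb : b = A X + nv)
    (lam : ℝ) (hlam : 0 < lam)
    (Xs : Matrix (Fin n₁) (Fin n₂) ℝ)
    (hXs : ∀ Z : Matrix (Fin n₁) (Fin n₂) ℝ,
      nucNorm Xs + (1 / (2 * lam)) * ‖b - A Xs‖ ^ 2 ≤
        nucNorm Z + (1 / (2 * lam)) * ‖b - A Z‖ ^ 2)
    (β₁ β₂ C₃ C₄ : ℝ)
    (hβ₁ : β₁ = 2 / ((1 - δ) * Real.sqrt (1 + δ)))
    (hβ₂ : β₂ = δ / Real.sqrt ((1 - δ ^ 2) * (t - 1)))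
    (hC₃ : C₃ = (2 * Real.sqrt k * β₁ * (2 * Real.sqrt k + 1 + β₂) * lam +
        2 * (Real.sqrt k * β₂ + 2 * β₂ + Real.sqrt k) * ε) / (k * β₁ * (1 - β₂) * lam))
    (hC₄ : C₄ = (2 * (k + Real.sqrt k) * β₁ * lam +
        (β₂ + 2 * Real.sqrt k - Real.sqrt k * β₂) * ε) * (Real.sqrt k * β₁ * lam + ε) /
        (Real.sqrt k * (1 - β₂) * lam)) :
    frobNorm (Xs - X) ≤ C₃ * (∑ i ∈ univ.filter fun i : Fin n₁ => k ≤ (i : ℕ), σ i) + C₄ := by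
  have ht0 : 0 < t := by linarith
  have hδt : δ ^ 2 * t < t - 1 := by
    have h1 := (Real.lt_sqrt hδ0.le).1 hδ
    rwa [lt_div_iff₀ ht0] at h1
  have hδ1 : δ < 1 := by
    by_contra! hle
    nlinarith [mul_le_mul_of_nonneg_right (one_le_pow₀ hle : 1 ≤ δ ^ 2) ht0.le]
  have hδsq : 0 < 1 - δ ^ 2 := by nlinarith
  have hdt : 0 < (1 - δ ^ 2) * (t - 1) := mul_pos hδsq (by linarith)
  have hβ₂0 : 0 < β₂ := by rw [hβ₂]; exact div_pos hδ0 (Real.sqrt_pos.2 hdt)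
  have hβ₂1 : β₂ < 1 := by
    rw [hβ₂, div_lt_one (Real.sqrt_pos.2 hdt), Real.lt_sqrt hδ0.le]
    nlinarith
  have h1δ : 0 < 1 - δ := by linarith
  have hsδ : 0 < √(1 + δ) := Real.sqrt_pos.2 (by linarith)
  have hβ₁0 : 0 < β₁ := by rw [hβ₁]; positivity
  have hε : 0 ≤ ε := (norm_nonneg nv).trans hnv
  have hkR : (1 : ℝ) ≤ k := by exact_mod_cast hk
  have hk0 : (0 : ℝ) < k := by linarith
  set r := √(k : ℝ) with hr
  have hr2 : r ^ 2 = k := Real.sq_sqrt hk0.le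
  have hr1 : 1 ≤ r := Real.one_le_sqrt.2 hkR
  have hr0 : 0 < r := by linarith
  have hSVD : IsSVD X σ u v := ⟨hσ0, hu, hv, hX⟩
  have hσanti : Antitone σ := fun i j hij => hσmono i j hij
  have hnucX := hSVD.nucNorm_eq hn hσanti
  obtain ⟨τ, p, q, hτ, hτanti, -⟩ := exists_isSVD_nucNorm hn (Xs - X)
  obtain ⟨d, g, h, hd, -, hdsum⟩ := exists_isSVD_nucNorm hn Xs
  have hmirsky := hSVD.sum_abs_sub_le hn hτ.neg hd hσanti hτanti (by abel)
  rw [hdsum] at hmirsky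
  set K : Finset (Fin n₁) := univ.filter fun i => (i : ℕ) < k with hKdef
  have hKc : (univ.filter fun i : Fin n₁ => k ≤ (i : ℕ)) = Kᶜ := by
    ext i
    simp [hKdef]
  have hKcard : K.card ≤ k := by
    calc K.card = (K.image fun i : Fin n₁ => (i : ℕ)).card :=
          (card_image_of_injective _ Fin.val_injective).symm
      _ ≤ (range k).card := card_le_card fun j hj => by
          obtain ⟨i, hi, rfl⟩ := mem_image.1 hj
          exact mem_range.2 (mem_filter.1 hi).2
      _ = k := card_range k
  rw [hKc]
  set S := ∑ i ∈ Kᶜ, σ i with hS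
  set T := ∑ i ∈ Kᶜ, τ i with hT
  have hS0 : 0 ≤ S := sum_nonneg fun i _ => hσ0 i
  have hT0 : 0 ≤ T := sum_nonneg fun i _ => hτ.nonneg i
  have hcone : nucNorm X - nucNorm Xs ≤ 2 * S + ∑ i ∈ K, τ i - T := by
    have h1 : ∑ i ∈ K, (σ i - τ i) ≤ ∑ i ∈ K, |σ i - τ i| :=
      sum_le_sum fun i _ => le_abs_self _
    have h2 : ∑ i ∈ Kᶜ, (τ i - σ i) ≤ ∑ i ∈ Kᶜ, |σ i - τ i| :=
      sum_le_sum fun i _ => by rw [abs_sub_comm]; exact le_abs_self _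
    have h3 := sum_add_sum_compl K fun i => |σ i - τ i|
    have h4 := sum_add_sum_compl K σ
    rw [sum_sub_distrib] at h1 h2
    linarith only [h1, h2, h3, h4, hmirsky, hnucX]
  have hkt : k < ⌈t * (k : ℝ)⌉₊ := Nat.lt_ceil.2 (by nlinarith)
  obtain ⟨s, hs⟩ := Nat.exists_eq_add_of_lt hkt
  rw [add_assoc] at hs
  have hsR : (t - 1) * k ≤ ((s + 1 : ℕ) : ℝ) := by
    have h1 := Nat.le_ceil (t * (k : ℝ))
    rw [hs] at h1
    push_cast at h1 ⊢
    linarith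
  rw [hs] at hRIP
  obtain ⟨x, hx0, hxK, hxF, hx⟩ := hRIP.exists_bound hδ0 s.succ_pos hτ K hKcard
  rw [← hT] at hxF hx
  set a := ‖A (Xs - X)‖ with ha
  have ha0 : 0 ≤ a := norm_nonneg _
  have hxa := le_of_robust_null_space_bound ht hδ0 hδ1 hk0 hr2 hr0 hβ₁ hβ₂ ha0 hT0 hsR hx
  have hKx : ∑ i ∈ K, τ i ≤ r * x := by
    refine le_of_sq_le_sq ?_ (by positivity)
    calc (∑ i ∈ K, τ i) ^ 2 ≤ K.card * ∑ i ∈ K, τ i ^ 2 := sq_sum_le_card_mul_sum_sq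
      _ ≤ k * x ^ 2 := by gcongr
      _ = (r * x) ^ 2 := by rw [mul_pow, hr2]
  have hopt := sq_residual_le_of_le A hlam hnv hb (hXs X)
  rw [← ha] at hopt
  have hres : a ^ 2 - 2 * (r * β₁ * lam + ε) * a + 2 * lam * (1 - β₂) * T ≤ 4 * lam * S := by
    have h1 : r * x ≤ r * β₁ * a + β₂ * T := by
      refine (mul_le_mul_of_nonneg_left hxa hr0.le).trans_eq ?_
      field_simp
    have h2 : nucNorm X - nucNorm Xs ≤ 2 * S + r * β₁ * a + β₂ * T - T := by
      linarith only [hcone, hKx, h1]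
    linarith only [hopt, mul_le_mul_of_nonneg_left h2 (by positivity : 0 ≤ 2 * lam)]
  have hfrob : frobNorm (Xs - X) ≤ x + T := by
    refine le_of_sq_le_sq ?_ (by positivity)
    linarith only [hxF, add_sq x T, mul_nonneg hx0 hT0]
  rw [hC₃, hC₄, ← hr2]
  exact hfrob.trans (le_of_residual_bounds hr0 hr1 hβ₁0 hβ₂0 hβ₂1 hε hlam hS0 hxa hres hT0)
end

section
/- Let A : ℝ^{n₁×n₂} → ℝ^m be a linear map satisfying the RIP of order ⌈tk⌉ (for fixed t > 1 and positive integer k) with restricted isometry constant δ_{tk} ∈ (0,1). Then for any matrix H ∈ ℝ^{n₁×n₂} and any subset E ⊆ {1,…,n₁} with |E| = k, it holds that ‖H_E‖_F ≤ β₁‖A(H)‖₂ + β₂·‖H_{E^c}‖_*/√k, where β₁ = 2/((1−δ_{tk})√(1+δ_{tk})) and β₂ = δ_{tk}/√((1−δ_{tk}²)(t−1)). -/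
open Finset

/-- A linear functional on the polytope `{y | 0 ≤ y ≤ a, ∑ y ≤ s a}` is bounded below by its value at
an `s`-sparse point of the box, supported in the support of the given point. -/
theorem exists_sparse_sum_mul_le {ι : Type*} [Fintype ι] [DecidableEq ι] (w : ι → ℝ) {a : ℝ}
    (s : ℕ) (y : ι → ℝ) (hy0 : ∀ i, 0 ≤ y i) (hya : ∀ i, y i ≤ a) (hys : ∑ i, y i ≤ s * a) :
    ∃ z : ι → ℝ, (∀ i, 0 ≤ z i) ∧ (∀ i, z i ≤ a) ∧ #{i | z i ≠ 0} ≤ s ∧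
      (∀ i, y i = 0 → z i = 0) ∧ ∑ i, w i * z i ≤ ∑ i, w i * y i := by
  induction hN : #{i | 0 < y i ∧ y i < a} using Nat.strong_induction_on generalizing y with
  | _ N ih =>
  by_cases hcard : #{i | 0 < y i ∧ y i < a} ≤ 1
  · refine ⟨y, hy0, hya, ?_, fun _ h => h, le_rfl⟩
    by_contra! hlt
    have hpos : ∀ i ∈ ({i | y i ≠ 0} : Finset ι), 0 < y i := fun i hi =>
      lt_of_le_of_ne (hy0 i) (Ne.symm (mem_filter.1 hi).2)
    obtain ⟨j, hj, hrest⟩ : ∃ j ∈ ({i | y i ≠ 0} : Finset ι),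
        ∀ i ∈ ({i | y i ≠ 0} : Finset ι).erase j, y i = a := by
      have hne : ({i | y i ≠ 0} : Finset ι).Nonempty := card_pos.1 (by omega)
      by_cases hfrac : ({i | 0 < y i ∧ y i < a} : Finset ι).Nonempty
      · obtain ⟨j, hj⟩ := hfrac
        refine ⟨j, by simp only [mem_filter, mem_univ, true_and] at hj ⊢; exact hj.1.ne', ?_⟩
        intro i hi
        obtain ⟨hij, hi⟩ := mem_erase.1 hi
        by_contra hia
        exact hij (card_le_one.1 hcard i
          (by simpa using ⟨hpos i hi, lt_of_le_of_ne (hya i) hia⟩) j hj)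
      · obtain ⟨j, hj⟩ := hne
        refine ⟨j, hj, fun i hi => ?_⟩
        by_contra hia
        exact hfrac ⟨i, by
          simpa using ⟨hpos i (mem_erase.1 hi).2, lt_of_le_of_ne (hya i) hia⟩⟩
    have hsum : ∑ i, y i = y j + (#{i | y i ≠ 0} - 1 : ℕ) * a := by
      rw [← sum_filter_ne_zero, ← add_sum_erase _ _ hj, sum_congr rfl hrest, sum_const,
        card_erase_of_mem hj, nsmul_eq_mul]
    have ha : 0 ≤ a := (hy0 j).trans (hya j)
    have hle : (s : ℝ) ≤ (#{i | y i ≠ 0} - 1 : ℕ) := by exact_mod_cast Nat.le_sub_one_of_lt hlt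
    nlinarith [hpos j hj, mul_le_mul_of_nonneg_right hle ha]
  · obtain ⟨i, hi, j, hj, hij⟩ := one_lt_card.1 (not_le.1 hcard)
    simp only [mem_filter, mem_univ, true_and] at hi hj
    wlog hw : w i ≤ w j generalizing i j
    · exact this j i hij.symm hj hi (le_of_not_ge hw)
    set ε := min (a - y i) (y j) with hε
    have hε0 : 0 < ε := lt_min (by linarith) hj.1
    have hεi : ε ≤ a - y i := min_le_left _ _
    have hεj : ε ≤ y j := min_le_right _ _
    set y' : ι → ℝ := Function.update (Function.update y i (y i + ε)) j (y j - ε) with hy'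
    have hy'i : y' i = y i + ε := by simp [hy', hij]
    have hy'j : y' j = y j - ε := by simp [hy']
    have hy'o : ∀ l, l ≠ i → l ≠ j → y' l = y l := fun l h1 h2 => by simp [hy', h1, h2]
    have hsum : ∀ g : ι → ℝ, ∑ l, g l * y' l = ∑ l, g l * y l + (g i - g j) * ε := by
      intro g
      have hl : ∀ l, g l * y' l = g l * y l + ((if l = i then g i * ε else 0)
          - (if l = j then g j * ε else 0)) := by
        intro l
        by_cases h1 : l = i
        · subst h1; rw [hy'i]; simp [hij]; ring
        · by_cases h2 : l = j
          · subst h2; rw [hy'j]; simp [h1]; ring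
          · rw [hy'o l h1 h2]; simp [h1, h2]
      simp only [hl, sum_add_distrib, sum_sub_distrib, sum_ite_eq', mem_univ, if_true]
      ring
    have hbound : ∀ l, 0 ≤ y' l ∧ y' l ≤ a := by
      intro l
      by_cases h1 : l = i
      · subst h1; rw [hy'i]; constructor <;> linarith
      · by_cases h2 : l = j
        · subst h2; rw [hy'j]; constructor <;> linarith
        · rw [hy'o l h1 h2]; exact ⟨hy0 l, hya l⟩
    have hlt : #{l | 0 < y' l ∧ y' l < a} < N := by
      rw [← hN]
      refine card_lt_card ((ssubset_iff_of_subset ?_).2 ?_)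
      · intro l hl
        simp only [mem_filter, mem_univ, true_and] at hl ⊢
        by_cases h1 : l = i
        · exact h1 ▸ hi
        · by_cases h2 : l = j
          · exact h2 ▸ hj
          · rwa [hy'o l h1 h2] at hl
      · rcases min_choice (a - y i) (y j) with h | h
        · refine ⟨i, by simpa using hi, ?_⟩
          simp only [mem_filter, mem_univ, true_and, hy'i]
          intro hc; linarith [hc.2]
        · refine ⟨j, by simpa using hj, ?_⟩
          simp only [mem_filter, mem_univ, true_and, hy'j]
          intro hc; linarith [hc.1]
    obtain ⟨z, hz0, hza, hzs, hzsupp, hzw⟩ := ih _ hlt y' (fun l => (hbound l).1)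
      (fun l => (hbound l).2) (by have := hsum 1; simp at this; linarith) rfl
    refine ⟨z, hz0, hza, hzs, fun l hl => hzsupp l ?_, hzw.trans ?_⟩
    · rw [hy'o l (by rintro rfl; linarith) (by rintro rfl; linarith), hl]
    · rw [hsum w]
      nlinarith

theorem le_of_le_mul_sqrt_add {δ X Y P : ℝ} (hδ0 : 0 < δ) (hδ1 : δ < 1) (hY : 0 ≤ Y) (hP : 0 ≤ P)
    (h : X ≤ δ * √(X ^ 2 + P ^ 2) + Y) : X ≤ Y / (1 - δ) + δ / √(1 - δ ^ 2) * P := by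
  have hw2 : 0 < 1 - δ ^ 2 := by nlinarith
  have hw : 0 < √(1 - δ ^ 2) := Real.sqrt_pos.2 hw2
  have hw' : √(1 - δ ^ 2) ^ 2 = 1 - δ ^ 2 := Real.sq_sqrt hw2.le
  set w := √(1 - δ ^ 2)
  set Q := P / w with hQ
  have hQ0 : 0 ≤ Q := by positivity
  have hPQ : P = w * Q := by rw [hQ]; field_simp
  have hX0 : δ / w * P = δ * Q := by rw [hQ]; ring
  rw [hX0]
  have hd : 0 < 1 - δ := by linarith
  have hYd : 0 ≤ Y / (1 - δ) := by positivity
  rcases le_total X (δ * Q) with hle | hle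
  · linarith
  have hsq : √(X ^ 2 + P ^ 2) ≤ Q + (X - δ * Q) := by
    refine Real.sqrt_le_iff.2 ⟨by linarith, ?_⟩
    rw [hPQ, mul_pow, hw']
    nlinarith [mul_nonneg (mul_nonneg hQ0 hd.le) (sub_nonneg.2 hle)]
  have hfin : (X - δ * Q) * (1 - δ) ≤ Y := by nlinarith
  have := (le_div_iff₀ hd).2 hfin
  linarith

/-- A bound on the inner product of the images of `b` and `b + z` under a map that is a near
isometry on the combinations of the orthogonal vectors `b` and `z`. -/
theorem sq_sub_le_inner_of_near_isometry {F : Type*} [NormedAddCommGroup F] [InnerProductSpace ℝ F]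
    (p q : F) {δ X P U : ℝ} (hδ : 0 ≤ δ) (hX : 0 < X) (hU : U ≤ P ^ 2)
    (h : ∀ x c : ℝ, (1 - δ) * (x ^ 2 * X ^ 2 + c ^ 2 * U) ≤ ‖x • p + c • q‖ ^ 2 ∧
      ‖x • p + c • q‖ ^ 2 ≤ (1 + δ) * (x ^ 2 * X ^ 2 + c ^ 2 * U)) :
    X ^ 2 - δ * X * √(X ^ 2 + P ^ 2) ≤ inner ℝ p (p + q) := by
  have hR : 0 < √(X ^ 2 + P ^ 2) := Real.sqrt_pos.2 (by positivity)
  have hR2 : √(X ^ 2 + P ^ 2) ^ 2 = X ^ 2 + P ^ 2 := Real.sq_sqrt (by positivity)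
  set R := √(X ^ 2 + P ^ 2)
  have hc : 0 < X / R := by positivity
  have hcR : X / R * R = X := by field_simp
  set c := X / R
  have h1 := (h (1 + c) c).1
  have h2 := (h (1 - c) (-c)).2
  have hexp : ∀ x y : ℝ, ‖x • p + y • q‖ ^ 2
      = x ^ 2 * ‖p‖ ^ 2 + 2 * (x * y) * inner ℝ p q + y ^ 2 * ‖q‖ ^ 2 := by
    intro x y
    rw [norm_add_sq_real, norm_smul, norm_smul, mul_pow, mul_pow, Real.norm_eq_abs,
      Real.norm_eq_abs, sq_abs, sq_abs, real_inner_smul_left, real_inner_smul_right]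
    ring
  rw [hexp] at h1 h2
  rw [inner_add_right, real_inner_self_eq_norm_sq]
  have hUc : δ * c ^ 2 * U ≤ δ * c ^ 2 * P ^ 2 := by gcongr
  have hcR2 : c ^ 2 * (X ^ 2 + P ^ 2) = X ^ 2 := by rw [← hR2, ← mul_pow, hcR]
  have hXX : X ^ 2 = c * (X * R) := by linear_combination -X * hcR
  have hkey : c * (X ^ 2 - δ * X * R) ≤ c * (‖p‖ ^ 2 + inner ℝ p q) := by
    have e : δ * c ^ 2 * P ^ 2 = δ * (X ^ 2 - c ^ 2 * X ^ 2) := by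
      linear_combination δ * hcR2
    have e2 : δ * X ^ 2 = δ * (c * (X * R)) := by rw [← hXX]
    linarith
  exact le_of_mul_le_mul_left hkey hc

/-- The robust null space property of a linear map with the restricted isometry property. -/
theorem sqrt_sum_sq_le_of_rip {ι F : Type*} [Fintype ι] [DecidableEq ι] [NormedAddCommGroup F]
    [InnerProductSpace ℝ F] (T : (ι → ℝ) →ₗ[ℝ] F) {k q : ℕ} {δ : ℝ} (hq : 0 < q) (hδ0 : 0 < δ)
    (hδ1 : δ < 1)
    (hT : ∀ x : ι → ℝ, #{i | x i ≠ 0} ≤ k + q →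
      (1 - δ) * ∑ i, x i ^ 2 ≤ ‖T x‖ ^ 2 ∧ ‖T x‖ ^ 2 ≤ (1 + δ) * ∑ i, x i ^ 2)
    (h : ι → ℝ) (h0 : ∀ i, 0 ≤ h i) (E : Finset ι) (hE : #E = k) :
    √(∑ i ∈ E, h i ^ 2) ≤
      √(1 + δ) / (1 - δ) * ‖T h‖ + δ / √(1 - δ ^ 2) * ((∑ i ∈ Eᶜ, h i) / √q) := by
  set S := ∑ i ∈ Eᶜ, h i with hS
  have hS0 : 0 ≤ S := sum_nonneg fun i _ => h0 i
  have hq' : (0 : ℝ) < q := by exact_mod_cast hq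
  set a := S / q with ha
  have ha0 : 0 ≤ a := by positivity
  have hSa : S = q * a := by rw [ha]; field_simp
  set M : Finset ι := {i ∈ Eᶜ | a < h i} with hM
  have hMS : ∑ i ∈ M, h i + ∑ i ∈ Eᶜ with ¬ a < h i, h i = S := sum_filter_add_sum_filter_not _ _ _
  have hMa : (#M : ℝ) * a ≤ ∑ i ∈ M, h i := by
    rw [← nsmul_eq_mul]
    exact card_nsmul_le_sum _ _ _ fun i hi => (mem_filter.1 hi).2.le
  have hrest : 0 ≤ ∑ i ∈ Eᶜ with ¬ a < h i, h i := sum_nonneg fun i _ => h0 i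
  have hMq : #M ≤ q := by
    rcases ha0.eq_or_lt with ha' | ha'
    · have : M = ∅ := by
        refine filter_eq_empty_iff.2 fun i hi hlt => ?_
        have : h i ≤ S := single_le_sum (fun i _ => h0 i) hi
        rw [hSa, ← ha', mul_zero] at this
        linarith
      simp [this]
    · have : (#M : ℝ) ≤ q := le_of_mul_le_mul_right (by linarith) ha'
      exact_mod_cast this
  have hdisj : Disjoint E M := disjoint_left.2 fun i hi hi' =>
    mem_compl.1 (mem_filter.1 hi').1 hi
  set G := E ∪ M with hG
  have hGcard : #G = k + #M := by rw [hG, card_union_of_disjoint hdisj, hE]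
  set b : ι → ℝ := fun i => if i ∈ G then h i else 0 with hb
  set y : ι → ℝ := fun i => if i ∈ G then 0 else h i with hy
  have hby : h = b + y := by ext i; by_cases hi : i ∈ G <;> simp [hb, hy, hi]
  have hGc : ({i ∈ Eᶜ | ¬ a < h i} : Finset ι) = Gᶜ := by
    ext i; simp [hG, hM]; tauto
  have hysum : ∑ i, y i ≤ ((q - #M : ℕ) : ℝ) * a := by
    have : ∑ i, y i = ∑ i ∈ Gᶜ, h i := by
      rw [← sum_add_sum_compl G, sum_eq_zero fun i hi => by simp [hy, hi], zero_add]
      exact sum_congr rfl fun i hi => by simp [hy, mem_compl.1 hi]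
    rw [this, ← hGc, Nat.cast_sub hMq, sub_mul]
    linarith
  obtain ⟨z, hz0, hza, hzs, hzsupp, hzw⟩ := exists_sparse_sum_mul_le
    (fun i => inner ℝ (T b) (T (Pi.single i 1))) (q - #M) y
    (fun i => by by_cases hi : i ∈ G <;> simp [hy, hi, h0])
    (fun i => by
      by_cases hi : i ∈ G
      · simpa [hy, hi] using ha0
      · have : i ∈ ({i ∈ Eᶜ | ¬ a < h i} : Finset ι) := by rw [hGc]; exact mem_compl.2 hi
        simpa [hy, hi] using (mem_filter.1 this).2) hysum
  have hinner : ∀ x : ι → ℝ, ∑ i, inner ℝ (T b) (T (Pi.single i 1)) * x i = inner ℝ (T b) (T x) := by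
    intro x
    conv_rhs => rw [pi_eq_sum_univ' x, map_sum, inner_sum]
    refine sum_congr rfl fun i _ => ?_
    rw [map_smul, real_inner_smul_right, mul_comm]
  rw [hinner, hinner] at hzw
  have hzG : ∀ i ∈ G, z i = 0 := fun i hi => hzsupp i (by simp [hy, hi])
  have hbG : ∀ i ∉ G, b i = 0 := fun i hi => by simp [hb, hi]
  have hUle : ∑ i, z i ^ 2 ≤ (S / √q) ^ 2 := by
    have h1 : ∑ i, z i ^ 2 ≤ #{i | z i ≠ 0} • a ^ 2 := by
      have : ∑ i, z i ^ 2 = ∑ i with z i ≠ 0, z i ^ 2 := by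
        refine (sum_filter_of_ne fun i _ hi => ?_).symm
        rintro h; simp [h] at hi
      rw [this]
      exact sum_le_card_nsmul _ _ _ fun i _ => pow_le_pow_left₀ (hz0 i) (hza i) 2
    rw [nsmul_eq_mul] at h1
    have h2 : (#{i | z i ≠ 0} : ℝ) ≤ q := by exact_mod_cast hzs.trans (Nat.sub_le _ _)
    have h3 : (S / √q) ^ 2 = q * a ^ 2 := by
      rw [div_pow, Real.sq_sqrt hq'.le, hSa]; field_simp
    rw [h3]
    exact h1.trans (by gcongr)
  set X := √(∑ i, b i ^ 2) with hX
  have hX2 : X ^ 2 = ∑ i, b i ^ 2 := Real.sq_sqrt (sum_nonneg fun i _ => sq_nonneg _)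
  have hEX : √(∑ i ∈ E, h i ^ 2) ≤ X := by
    refine Real.sqrt_le_sqrt ?_
    have : ∑ i ∈ E, h i ^ 2 = ∑ i ∈ E, b i ^ 2 :=
      sum_congr rfl fun i hi => by simp [hb, hG, hi]
    rw [this]
    exact sum_le_univ_sum_of_nonneg fun i => sq_nonneg _
  refine hEX.trans ?_
  have hd : 0 < 1 - δ := by linarith
  have hcomb : ∀ x c : ℝ, (1 - δ) * (x ^ 2 * X ^ 2 + c ^ 2 * ∑ i, z i ^ 2) ≤ ‖x • T b + c • T z‖ ^ 2
      ∧ ‖x • T b + c • T z‖ ^ 2 ≤ (1 + δ) * (x ^ 2 * X ^ 2 + c ^ 2 * ∑ i, z i ^ 2) := by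
    intro x c
    have hsupp : #{i | (x • b + c • z) i ≠ 0} ≤ k + q := by
      have hsub : ({i | (x • b + c • z) i ≠ 0} : Finset ι) ⊆ G ∪ ({i | z i ≠ 0} : Finset ι) := by
        intro i hi
        by_contra hn
        simp only [mem_union, mem_filter, mem_univ, true_and, not_or, not_not] at hn
        simp [hbG i hn.1, hn.2] at hi
      have := (card_le_card hsub).trans (card_union_le _ _)
      omega
    have hsq : ∑ i, (x • b + c • z) i ^ 2 = x ^ 2 * X ^ 2 + c ^ 2 * ∑ i, z i ^ 2 := by
      rw [hX2, mul_sum, mul_sum, ← sum_add_distrib]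
      refine sum_congr rfl fun i _ => ?_
      by_cases hi : i ∈ G
      · simp [hzG i hi, mul_pow]
      · simp [hbG i hi, mul_pow]
    have := hT _ hsupp
    rwa [hsq, map_add, map_smul, map_smul] at this
  have hmain : X ≤ δ * √(X ^ 2 + (S / √q) ^ 2) + √(1 + δ) * ‖T h‖ := by
    rcases (Real.sqrt_nonneg (∑ i, b i ^ 2)).eq_or_lt with hX0 | hX0
    · rw [← hX] at hX0
      rw [← hX0]; positivity
    · have h1 := sq_sub_le_inner_of_near_isometry (T b) (T z) hδ0.le hX0 hUle hcomb
      have h2 : inner ℝ (T b) (T b + T z) ≤ inner ℝ (T b) (T h) := by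
        conv_rhs => rw [hby, map_add]
        rw [inner_add_right, inner_add_right]
        linarith
      have h3 := real_inner_le_norm (T b) (T h)
      have h4 : ‖T b‖ ≤ √(1 + δ) * X := by
        have := (hcomb 1 0).2
        simp only [one_smul, zero_smul, add_zero, one_pow, one_mul] at this
        refine (sq_le_sq₀ (norm_nonneg _) (by positivity)).1 ?_
        rw [mul_pow, Real.sq_sqrt (by linarith)]
        linarith
      have h5 : ‖T b‖ * ‖T h‖ ≤ √(1 + δ) * X * ‖T h‖ := by gcongr
      refine le_of_mul_le_mul_left (a := X) ?_ hX0
      linarith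
  refine (le_of_le_mul_sqrt_add hδ0 hδ1 (by positivity) (by positivity) hmain).trans_eq ?_
  ring

theorem rank_sum_smul_vecMulVec_le {m n ι : Type*} [Fintype m] [Fintype n] [Fintype ι]
    (x : ι → ℝ) (u : ι → m → ℝ) (v : ι → n → ℝ) :
    (∑ i, x i • Matrix.vecMulVec (u i) (v i)).rank ≤ #{i | x i ≠ 0} := by
  classical
  let P : Matrix m {i // x i ≠ 0} ℝ := Matrix.of fun a i => x i * u i a
  let Q : Matrix {i // x i ≠ 0} n ℝ := Matrix.of fun i b => v i b
  have hPQ : ∑ i, x i • Matrix.vecMulVec (u i) (v i) = P * Q := by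
    ext a b
    simp only [Matrix.sum_apply, Matrix.mul_apply, Matrix.smul_apply, Matrix.vecMulVec_apply,
      smul_eq_mul, P, Q, Matrix.of_apply, ← mul_assoc]
    rw [← sum_subtype {i | x i ≠ 0} (by simp) fun i => x i * u i a * v i b]
    refine (sum_filter_of_ne fun i _ hi => ?_).symm
    rintro h; simp [h] at hi
  rw [hPQ, ← Fintype.card_subtype]
  exact (Matrix.rank_mul_le_left P Q).trans (Matrix.rank_le_card_width P)

theorem frobNorm_sum_smul_vecMulVec {n₁ n₂ : ℕ} {ι : Type*} [Fintype ι] [DecidableEq ι]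
    (x : ι → ℝ) (u : ι → Fin n₁ → ℝ) (v : ι → Fin n₂ → ℝ)
    (hu : ∀ i j, ∑ a, u i a * u j a = if i = j then (1 : ℝ) else 0)
    (hv : ∀ i j, ∑ b, v i b * v j b = if i = j then (1 : ℝ) else 0) :
    frobNorm (∑ i, x i • Matrix.vecMulVec (u i) (v i)) = √(∑ i, x i ^ 2) := by
  unfold frobNorm
  refine congrArg _ ?_
  have hexp : ∀ a b, (∑ i, x i • Matrix.vecMulVec (u i) (v i)) a b ^ 2
      = ∑ i, ∑ j, x i * x j * ((u i a * u j a) * (v i b * v j b)) := by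
    intro a b
    rw [Matrix.sum_apply, sq, sum_mul_sum]
    refine sum_congr rfl fun i _ => sum_congr rfl fun j _ => ?_
    simp only [Matrix.smul_apply, Matrix.vecMulVec_apply, smul_eq_mul]
    ring
  calc _ = ∑ i, ∑ j, x i * x j * ((∑ a, u i a * u j a) * ∑ b, v i b * v j b) := by
        simp only [hexp]
        rw [sum_comm_cycle]
        refine sum_congr rfl fun i _ => ?_
        rw [sum_comm_cycle]
        refine sum_congr rfl fun j _ => ?_
        rw [sum_mul_sum]
        simp only [mul_sum]
    _ = ∑ i, x i ^ 2 := by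
        simp [hu, hv, sq]

theorem stmt2 {n₁ n₂ m k : ℕ} (hk : 0 < k) (hn : n₁ ≤ n₂)
    (A : Matrix (Fin n₁) (Fin n₂) ℝ →ₗ[ℝ] EuclideanSpace ℝ (Fin m))
    (t δ : ℝ) (ht : 1 < t) (hδ0 : 0 < δ) (hδ1 : δ < 1)
    (hRIP : HasRIP A ⌈t * (k : ℝ)⌉₊ δ)
    (H : Matrix (Fin n₁) (Fin n₂) ℝ)
    -- SVD of `H`, with singular values `σ` in decreasing order
    (σ : Fin n₁ → ℝ) (u : Fin n₁ → Fin n₁ → ℝ) (v : Fin n₁ → Fin n₂ → ℝ)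
    (hσ0 : ∀ i, 0 ≤ σ i) (hσmono : ∀ i j : Fin n₁, i ≤ j → σ j ≤ σ i)
    (hu : ∀ i j, ∑ a, u i a * u j a = if i = j then (1 : ℝ) else 0)
    (hv : ∀ i j, ∑ b, v i b * v j b = if i = j then (1 : ℝ) else 0)
    (hH : H = ∑ i, rank1 (σ i) (u i) (v i))
    (E : Finset (Fin n₁)) (hE : E.card = k)
    (β₁ β₂ : ℝ)
    (hβ₁ : β₁ = 2 / ((1 - δ) * Real.sqrt (1 + δ)))
    (hβ₂ : β₂ = δ / Real.sqrt ((1 - δ ^ 2) * (t - 1))) :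
    frobNorm (∑ i ∈ E, rank1 (σ i) (u i) (v i)) ≤
      β₁ * ‖A H‖ + β₂ * (∑ i ∈ Eᶜ, σ i) / Real.sqrt k := by
  set r := ⌈t * (k : ℝ)⌉₊ with hr
  have hk' : (0 : ℝ) < k := by exact_mod_cast hk
  have hkr : k < r := Nat.lt_ceil.2 (by nlinarith)
  have hq : (t - 1) * k ≤ ((r - k : ℕ) : ℝ) := by
    rw [Nat.cast_sub hkr.le]
    linarith [Nat.le_ceil (t * (k : ℝ))]
  let Φ : (Fin n₁ → ℝ) →ₗ[ℝ] Matrix (Fin n₁) (Fin n₂) ℝ :=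
    Fintype.linearCombination ℝ fun i => Matrix.vecMulVec (u i) (v i)
  have hΦ : ∀ x, Φ x = ∑ i, x i • Matrix.vecMulVec (u i) (v i) := fun x =>
    Fintype.linearCombination_apply _ _ _
  have hrank1 : ∀ s i, rank1 s (u i) (v i) = s • Matrix.vecMulVec (u i) (v i) := by
    intro s i
    ext a b
    simp [rank1, Matrix.vecMulVec_apply, mul_assoc]
  have hfrob : ∀ x, frobNorm (Φ x) = √(∑ i, x i ^ 2) := fun x => by
    rw [hΦ]; exact frobNorm_sum_smul_vecMulVec x u v hu hv
  have hHΦ : H = Φ σ := by rw [hH, hΦ]; simp only [hrank1]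
  have hEΦ : frobNorm (∑ i ∈ E, rank1 (σ i) (u i) (v i)) = √(∑ i ∈ E, σ i ^ 2) := by
    have : ∑ i ∈ E, rank1 (σ i) (u i) (v i) = Φ fun i => if i ∈ E then σ i else 0 := by
      rw [hΦ]; simp [hrank1, ite_smul, sum_ite_mem]
    rw [this, hfrob]
    simp [ite_pow, sum_ite_mem]
  have key := sqrt_sum_sq_le_of_rip (A ∘ₗ Φ) (k := k) (q := r - k) (by omega) hδ0 hδ1
    (fun x hx => by
      have := hRIP (Φ x) (by
        rw [hΦ]
        exact (rank_sum_smul_vecMulVec_le x u v).trans (by omega))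
      rwa [hfrob, Real.sq_sqrt (sum_nonneg fun i _ => sq_nonneg _)] at this)
    σ hσ0 E hE
  rw [hEΦ]
  refine key.trans ?_
  rw [LinearMap.comp_apply, ← hHΦ]
  have hd : 0 < 1 - δ := by linarith
  have hd2 : 0 < 1 - δ ^ 2 := by nlinarith
  have ht' : 0 < t - 1 := by linarith
  have hS0 : 0 ≤ ∑ i ∈ Eᶜ, σ i := sum_nonneg fun i _ => hσ0 i
  have h1 : √(1 + δ) / (1 - δ) ≤ β₁ := by
    have hs : 0 < √(1 + δ) := Real.sqrt_pos.2 (by linarith)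
    rw [hβ₁, div_le_div_iff₀ hd (by positivity)]
    nlinarith [Real.mul_self_sqrt (show 0 ≤ 1 + δ by linarith)]
  have h2 : δ / √(1 - δ ^ 2) * ((∑ i ∈ Eᶜ, σ i) / √((r - k : ℕ) : ℝ))
      ≤ β₂ * (∑ i ∈ Eᶜ, σ i) / √(k : ℝ) := by
    have hsq : √(t - 1) * √(k : ℝ) ≤ √((r - k : ℕ) : ℝ) := by
      rw [← Real.sqrt_mul ht'.le]; exact Real.sqrt_le_sqrt hq
    have hpos : 0 < √(t - 1) * √(k : ℝ) := by positivity
    calc _ ≤ δ / √(1 - δ ^ 2) * ((∑ i ∈ Eᶜ, σ i) / (√(t - 1) * √(k : ℝ))) := by gcongr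
      _ = _ := by
        rw [hβ₂, Real.sqrt_mul hd2.le]
        field_simp
  gcongr
end

section
/- Let A : ℝ^{n₁×n₂} → ℝ^m be a linear map, X ∈ ℝ^{n₁×n₂}, n ∈ ℝ^m with ‖n‖₂ ≤ ε, b = A(X) + n, and λ > 0. Let X♯ be any minimizer of Z ↦ ‖Z‖_* + (1/(2λ))‖b − A(Z)‖₂², and set H = X♯ − X. Then for any subset E ⊆ {1,…,n₁} with |E| = k, it holds that ‖A(H)‖₂² − 2ε‖A(H)‖₂ ≤ 2λ(‖H_E‖_* − ‖H_{E^c}‖_* + 2‖X_{E^c}‖_*). -/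
open Finset

section Weyl

open Module

variable {V : Type*} [NormedAddCommGroup V] [InnerProductSpace ℝ V] [FiniteDimensional ℝ V]

/-- The lower half of the Courant–Fischer principle. -/
theorem LinearMap.IsSymmetric.le_eigenvalues_of_submodule {T : V →ₗ[ℝ] V} (hT : T.IsSymmetric)
    {N : ℕ} (hN : finrank ℝ V = N) (i : Fin N) (W : Submodule ℝ V)
    (hW : (i : ℕ) + 1 ≤ finrank ℝ W) {c : ℝ} (hc : ∀ x ∈ W, c * ‖x‖ ^ 2 ≤ inner ℝ (T x) x) :
    c ≤ hT.eigenvalues hN i := by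
  set e := hT.eigenvectorBasis hN with he
  let U : Submodule ℝ V := Submodule.span ℝ (Set.range fun j : Fin (i : ℕ) => e ⟨j, j.2.trans i.2⟩)
  have hU : finrank ℝ U ≤ i :=
    (finrank_range_le_card (R := ℝ) fun j : Fin (i : ℕ) => e ⟨j, j.2.trans i.2⟩).trans_eq
      (Fintype.card_fin _)
  have hne : Uᗮ ⊓ W ≠ ⊥ := by
    intro h
    have h1 := Submodule.finrank_sup_add_finrank_inf_eq Uᗮ W
    have h2 := U.finrank_add_finrank_orthogonal
    have h3 := Submodule.finrank_le (Uᗮ ⊔ W)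
    rw [h, finrank_bot] at h1
    omega
  obtain ⟨x, hx, hx0⟩ := Submodule.exists_mem_ne_zero_of_ne_bot hne
  have hxU : ∀ j : Fin N, j < i → inner ℝ (e j) x = 0 := fun j hj =>
    hx.1 _ (Submodule.subset_span ⟨⟨j, hj⟩, rfl⟩)
  have hpos : 0 < ‖x‖ ^ 2 := by positivity
  refine le_of_mul_le_mul_right ((hc x hx.2).trans ?_) hpos
  rw [← e.sum_inner_mul_inner, ← e.sum_sq_inner_right, Finset.mul_sum]
  refine Finset.sum_le_sum fun j _ => ?_
  rw [hT, he, hT.apply_eigenvectorBasis, ← he, inner_smul_right, real_inner_comm, mul_assoc, ← sq]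
  rcases lt_or_ge j i with hj | hj
  · simp [hxU j hj]
  · exact mul_le_mul_of_nonneg_right (hT.eigenvalues_antitone hN hj) (sq_nonneg _)

variable {T : V →ₗ[ℝ] V} {n : ℕ} {σ : Fin n → ℝ} {p w : Fin n → V}

theorem LinearMap.IsSymmetric.singularValue_le_eigenvalues (hT : T.IsSymmetric)
    {N : ℕ} (hN : finrank ℝ V = N) (hσ0 : ∀ i, 0 ≤ σ i) (hσ : Antitone σ)
    (hp : Orthonormal ℝ p) (hpw : ∀ i j, inner ℝ (w i) (p j) = 0)
    (hb : ∀ x, ∑ l, σ l * (inner ℝ (p l) x ^ 2 - inner ℝ (w l) x ^ 2) ≤ inner ℝ (T x) x)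
    (i : Fin n) (j : Fin N) (hij : (j : ℕ) = i) : σ i ≤ hT.eigenvalues hN j := by
  let f : Fin ((i : ℕ) + 1) → Fin n := fun l => ⟨l, by omega⟩
  have hf : Function.Injective f := fun a b h => by simpa [f, Fin.ext_iff] using h
  have hpf : Orthonormal ℝ (fun k => p (f k)) := hp.comp f hf
  refine hT.le_eigenvalues_of_submodule hN j (Submodule.span ℝ (Set.range fun k => p (f k)))
    (by rw [finrank_span_eq_card hpf.linearIndependent]; simp [hij]) fun x hx => le_trans ?_ (hb x)
  obtain ⟨c, hcx⟩ := (Submodule.mem_span_range_iff_exists_fun ℝ).1 hx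
  have hw : ∀ l, inner ℝ (w l) x = 0 := fun l => by
    simp [← hcx, inner_sum, inner_smul_right, hpw]
  have hpx : ∀ k, inner ℝ (p (f k)) x = c k := fun k => by
    rw [← hcx]; exact hpf.inner_right_fintype c k
  have hn : ‖x‖ ^ 2 = ∑ k, inner ℝ (p (f k)) x ^ 2 := by
    rw [← real_inner_self_eq_norm_sq]
    nth_rw 1 [← hcx]
    simp [sum_inner, inner_smul_left, hpx, sq]
  have hsub : ∑ k, σ (f k) * inner ℝ (p (f k)) x ^ 2 ≤ ∑ l, σ l * inner ℝ (p l) x ^ 2 := by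
    rw [← Finset.sum_image (s := univ) (g := f)
      (f := fun l => σ l * inner ℝ (p l) x ^ 2) hf.injOn]
    exact Finset.sum_le_sum_of_subset_of_nonneg (subset_univ _)
      fun l _ _ => mul_nonneg (hσ0 l) (sq_nonneg _)
  simp only [hw, ne_eq, OfNat.ofNat_ne_zero, not_false_eq_true, zero_pow, sub_zero]
  refine le_trans ?_ hsub
  rw [hn, Finset.mul_sum]
  refine Finset.sum_le_sum fun k _ => mul_le_mul_of_nonneg_right (hσ ?_) (sq_nonneg _)
  exact Fin.le_def.2 (Nat.lt_succ_iff.1 k.2)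

theorem LinearMap.IsSymmetric.neg_le_eigenvalues_rev (hT : T.IsSymmetric)
    {N : ℕ} (hN : finrank ℝ V = N) (hσ0 : ∀ i, 0 ≤ σ i) (hw : Orthonormal ℝ w)
    (hb : ∀ x, ∑ l, σ l * (inner ℝ (p l) x ^ 2 - inner ℝ (w l) x ^ 2) ≤ inner ℝ (T x) x)
    (j : Fin N) {s : ℝ} (hs : 0 ≤ s) (hsσ : ∀ l : Fin n, (j : ℕ) ≤ l → σ l ≤ s) :
    -s ≤ hT.eigenvalues hN j.rev := by
  classical
  let S : Finset (Fin n) := {l | (l : ℕ) < j}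
  have hS : S.card ≤ j := by
    simpa using Finset.card_le_card_of_injOn (s := S) (t := Finset.range j) (fun l => (l : ℕ))
      (by intro l hl; simpa [S] using hl) (Fin.val_injective.injOn)
  let U : Submodule ℝ V := Submodule.span ℝ (S.image w : Set V)
  have hU : finrank ℝ U ≤ j :=
    (finrank_span_finset_le_card (R := ℝ) (S.image w)).trans (Finset.card_image_le.trans hS)
  refine hT.le_eigenvalues_of_submodule hN j.rev Uᗮ ?_ fun x hx => le_trans ?_ (hb x)
  · have := U.finrank_add_finrank_orthogonal
    rw [Fin.val_rev]
    omega
  · have hx0 : ∀ l : Fin n, (l : ℕ) < j → inner ℝ (w l) x = 0 := fun l hl =>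
      hx _ (Submodule.subset_span (by
        simpa using ⟨l, by simpa [S] using hl, rfl⟩))
    have hB : ∑ l, inner ℝ (w l) x ^ 2 ≤ ‖x‖ ^ 2 := by
      simpa using hw.sum_inner_products_le (s := univ) x
    calc -s * ‖x‖ ^ 2 ≤ -s * ∑ l, inner ℝ (w l) x ^ 2 := by nlinarith
      _ ≤ _ := by
        rw [Finset.mul_sum]
        refine Finset.sum_le_sum fun l _ => ?_
        have h1 := mul_nonneg (hσ0 l) (sq_nonneg (inner ℝ (p l) x))
        rcases lt_or_ge (l : ℕ) j with hl | hl
        · rw [hx0 l hl]; linarith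
        · have := mul_le_mul_of_nonneg_right (hsσ l hl) (sq_nonneg (inner ℝ (w l) x))
          linarith

theorem LinearMap.IsSymmetric.sum_abs_sub_le_trace (hT : T.IsSymmetric) {d : ℕ}
    (hN : finrank ℝ V = n + (n + d)) (hσ0 : ∀ i, 0 ≤ σ i) (hσ : Antitone σ)
    (hp : Orthonormal ℝ p) (hw : Orthonormal ℝ w) (hpw : ∀ i j, inner ℝ (w i) (p j) = 0)
    (hb : ∀ x, ∑ l, σ l * (inner ℝ (p l) x ^ 2 - inner ℝ (w l) x ^ 2) ≤ inner ℝ (T x) x)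
    {τ : Fin n → ℝ} {p' w' : Fin n → V} (hτ0 : ∀ i, 0 ≤ τ i) (hτ : Antitone τ)
    (hp' : Orthonormal ℝ p') (hw' : Orthonormal ℝ w') (hpw' : ∀ i j, inner ℝ (w' i) (p' j) = 0)
    (hb' : ∀ x, ∑ l, τ l * (inner ℝ (p' l) x ^ 2 - inner ℝ (w' l) x ^ 2) ≤ inner ℝ (T x) x) :
    ∑ i, |σ i - τ i| ≤ LinearMap.trace ℝ V T := by
  rw [hT.trace_eq_sum_eigenvalues hN]
  simp only [RCLike.ofReal_real_eq_id, id_eq]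
  have htop : ∀ i : Fin n, max (σ i) (τ i) ≤ hT.eigenvalues hN (Fin.castAdd (n + d) i) := fun i =>
    max_le (hT.singularValue_le_eigenvalues hN hσ0 hσ hp hpw hb i _ rfl)
      (hT.singularValue_le_eigenvalues hN hτ0 hτ hp' hpw' hb' i _ rfl)
  have hbot : ∀ i : Fin n, -min (σ i) (τ i) ≤
      hT.eigenvalues hN (Fin.natAdd n (Fin.castAdd d i).rev) := fun i => by
    have hrev : Fin.natAdd n (Fin.castAdd d i).rev = (Fin.castAdd (n + d) i).rev := by
      ext; simp; omega
    rw [hrev, ← max_neg_neg]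
    exact max_le
      (hT.neg_le_eigenvalues_rev hN hσ0 hw hb _ (hσ0 i) fun l hl => hσ (Fin.le_def.2 hl))
      (hT.neg_le_eigenvalues_rev hN hτ0 hw' hb' _ (hτ0 i) fun l hl => hτ (Fin.le_def.2 hl))
  have hmid : ∀ j : Fin d, 0 ≤ hT.eigenvalues hN (Fin.natAdd n (Fin.natAdd n j).rev) := fun j => by
    have hrev : Fin.natAdd n (Fin.natAdd n j).rev =
        (Fin.castLE (by omega) (Fin.natAdd n j) : Fin (n + (n + d))).rev := by
      ext; simp; omega
    rw [hrev, ← neg_zero]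
    refine hT.neg_le_eigenvalues_rev hN hσ0 hw hb _ le_rfl fun l hl => ?_
    simp at hl
    omega
  rw [Fin.sum_univ_add, ← Equiv.sum_comp Fin.revPerm (fun j => hT.eigenvalues hN (Fin.natAdd n j)),
    Fin.sum_univ_add]
  simp only [Fin.revPerm_apply]
  have h1 := Finset.sum_le_sum fun i (_ : i ∈ univ) => htop i
  have h2 := Finset.sum_le_sum fun i (_ : i ∈ univ) => hbot i
  have h3 := Finset.sum_nonneg fun j (_ : j ∈ univ) => hmid j
  have h4 : ∑ i, |σ i - τ i| = ∑ i, max (σ i) (τ i) + ∑ i, -min (σ i) (τ i) := by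
    rw [← Finset.sum_add_distrib]
    exact Finset.sum_congr rfl fun i _ => by rw [← max_sub_min_eq_abs']; ring
  linarith

end Weyl

section Nuclear

open Matrix

variable {n₁ n₂ : ℕ}

theorem dotProduct_rank1_mulVec (s : ℝ) (u : Fin n₁ → ℝ) (v : Fin n₂ → ℝ) (x : Fin n₁ → ℝ)
    (y : Fin n₂ → ℝ) : x ⬝ᵥ (rank1 s u v *ᵥ y) = s * ((u ⬝ᵥ x) * (v ⬝ᵥ y)) := by
  simp only [rank1, dotProduct, mulVec, of_apply, Finset.mul_sum, Finset.sum_mul]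
  rw [Finset.sum_comm]
  exact Finset.sum_congr rfl fun _ _ => Finset.sum_congr rfl fun _ _ => by ring

theorem dotProduct_sum_rank1_mulVec {ι : Type*} [Fintype ι] (s : ι → ℝ) (u : ι → Fin n₁ → ℝ)
    (v : ι → Fin n₂ → ℝ) (x : Fin n₁ → ℝ) (y : Fin n₂ → ℝ) :
    x ⬝ᵥ ((∑ i, rank1 (s i) (u i) (v i)) *ᵥ y) = ∑ i, s i * ((u i ⬝ᵥ x) * (v i ⬝ᵥ y)) := by
  simp only [Matrix.sum_mulVec, dotProduct_sum, dotProduct_rank1_mulVec]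

/-- A decomposition of `M` into rank-one matrices whose weights are its singular values. -/
theorem exists_sum_rank1_eq (M : Matrix (Fin n₁) (Fin n₂) ℝ) :
    ∃ (s : Fin n₁ → ℝ) (u : Fin n₁ → Fin n₁ → ℝ) (q : Fin n₁ → Fin n₂ → ℝ),
      (∀ i, 0 ≤ s i) ∧ ∑ i, s i = nucNorm M ∧ (∀ i, s i * (u i ⬝ᵥ u i) = s i) ∧
        (∀ i, s i * (q i ⬝ᵥ q i) = s i) ∧ M = ∑ i, rank1 (s i) (u i) (q i) := by
  have hG := Matrix.isHermitian_mul_conjTranspose_self M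
  set B := hG.eigenvectorBasis
  set e := hG.eigenvalues
  have he0 : ∀ i, 0 ≤ e i := (posSemidef_self_mul_conjTranspose M).eigenvalues_nonneg
  let u : Fin n₁ → Fin n₁ → ℝ := fun i => B i
  have huu : ∀ i, u i ⬝ᵥ u i = 1 := fun i => by
    have := real_inner_self_eq_norm_sq (B i)
    rw [B.orthonormal.1 i, EuclideanSpace.inner_eq_star_dotProduct] at this
    simpa [u] using this
  have hMu : ∀ i, (u i ᵥ* M) ⬝ᵥ (u i ᵥ* M) = e i := fun i => by
    have h := hG.mulVec_eigenvectorBasis i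
    rw [← mulVec_mulVec] at h
    have hMt : Mᴴ *ᵥ u i = u i ᵥ* M := by
      rw [conjTranspose_eq_transpose_of_trivial, mulVec_transpose]
    rw [← dotProduct_mulVec, ← hMt, show M *ᵥ (Mᴴ *ᵥ u i) = e i • u i from h, dotProduct_smul, huu,
      smul_eq_mul, mul_one]
  have hs : ∀ i, √(e i) • ((√(e i))⁻¹ • (u i ᵥ* M)) = u i ᵥ* M := fun i => by
    by_cases h : √(e i) = 0
    · have h0 := hMu i
      rw [(Real.sqrt_eq_zero (he0 i)).1 h, dotProduct_self_eq_zero] at h0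
      simp [h0]
    · rw [smul_smul, mul_inv_cancel₀ h, one_smul]
  refine ⟨fun i => √(e i), u, fun i => (√(e i))⁻¹ • (u i ᵥ* M), fun i => Real.sqrt_nonneg _, rfl,
    fun i => by rw [huu, mul_one], fun i => ?_, ?_⟩
  · rw [dotProduct_smul, smul_dotProduct, hMu, smul_eq_mul, smul_eq_mul]
    by_cases h : √(e i) = 0
    · simp [h]
    · have := Real.mul_self_sqrt (he0 i)
      field_simp
      linarith
  · ext a b
    have hid := B.sum_inner_mul_inner (EuclideanSpace.single a 1) (WithLp.toLp 2 (M.col b))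
    simp [EuclideanSpace.inner_eq_star_dotProduct] at hid
    simp only [Matrix.sum_apply, rank1, of_apply]
    rw [← hid]
    refine Finset.sum_congr rfl fun i _ => ?_
    have := congrFun (hs i) b
    simp only [Pi.smul_apply, smul_eq_mul] at this ⊢
    rw [mul_right_comm, this]
    simp [vecMul, u, mul_comm, dotProduct, col]

/-- The nuclear norm is the sum of the weights of any singular value decomposition. -/
theorem nucNorm_sum_rank1 {σ : Fin n₁ → ℝ} {u : Fin n₁ → Fin n₁ → ℝ} {v : Fin n₁ → Fin n₂ → ℝ}
    (hσ : ∀ i, 0 ≤ σ i) (hu : ∀ i j, ∑ a, u i a * u j a = if i = j then (1 : ℝ) else 0)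
    (hv : ∀ i j, ∑ b, v i b * v j b = if i = j then (1 : ℝ) else 0) :
    nucNorm (∑ i, rank1 (σ i) (u i) (v i)) = ∑ i, σ i := by
  set M := ∑ i, rank1 (σ i) (u i) (v i) with hM
  let U : Matrix (Fin n₁) (Fin n₁) ℝ := of u
  let W : Matrix (Fin n₁) (Fin n₂) ℝ := of v
  have hU : U * Uᵀ = 1 := by
    ext i j
    simp [U, mul_apply, hu, one_apply]
  have hW : W * Wᵀ = 1 := by
    ext i j
    simp [W, mul_apply, hv, one_apply]
  have hMUW : M = Uᵀ * diagonal σ * W := by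
    ext a b
    rw [mul_apply]
    simp [hM, Matrix.sum_apply, rank1, U, W, mul_diagonal, mul_comm]
  have hG : M * Mᴴ = Uᵀ * diagonal (fun i => σ i ^ 2) * U := by
    rw [conjTranspose_eq_transpose_of_trivial, hMUW]
    simp only [transpose_mul, diagonal_transpose, transpose_transpose, Matrix.mul_assoc]
    rw [← Matrix.mul_assoc W, hW, Matrix.one_mul, ← Matrix.mul_assoc (diagonal σ),
      diagonal_mul_diagonal]
    simp only [sq]
  have hH := isHermitian_mul_conjTranspose_self M
  have hroots : Multiset.map hH.eigenvalues univ.val = Multiset.map (fun i => σ i ^ 2) univ.val := by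
    have h1 := hH.roots_charpoly_eq_eigenvalues
    have h2 : (M * Mᴴ).charpoly = _ := congrArg charpoly hG
    rw [charpoly_mul_comm, ← Matrix.mul_assoc, hU, Matrix.one_mul, charpoly_diagonal] at h2
    rw [h2, Polynomial.roots_prod _ _
      (Finset.prod_ne_zero_iff.2 fun i _ => Polynomial.X_sub_C_ne_zero _)] at h1
    simp only [Polynomial.roots_X_sub_C, Multiset.bind_singleton] at h1
    exact h1.symm
  have h2 := congrArg (fun m => (m.map Real.sqrt).sum) hroots
  simp only [Multiset.map_map, Function.comp_def, Real.sqrt_sq (hσ _)] at h2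
  exact h2

/-- The vector `(u, v) / √2`, an eigenvector of the Hermitian dilation of a matrix with
singular vectors `u`, `v`. -/
noncomputable def dilVec (u : Fin n₁ → ℝ) (v : Fin n₂ → ℝ) :
    EuclideanSpace ℝ (Fin n₁ ⊕ Fin n₂) :=
  WithLp.toLp 2 (Sum.elim (fun i => (√2)⁻¹ * u i) (fun j => (√2)⁻¹ * v j))

theorem inner_dilVec_left (u : Fin n₁ → ℝ) (v : Fin n₂ → ℝ)
    (x : EuclideanSpace ℝ (Fin n₁ ⊕ Fin n₂)) :
    inner ℝ (dilVec u v) x =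
      (√2)⁻¹ * (u ⬝ᵥ (fun i => x (Sum.inl i)) + v ⬝ᵥ (fun j => x (Sum.inr j))) := by
  simp only [dilVec, PiLp.inner_apply, Fintype.sum_sum_type, Sum.elim_inl, Sum.elim_inr,
    RCLike.inner_apply, conj_trivial, dotProduct, mul_add, Finset.mul_sum]
  congr 1 <;> exact Finset.sum_congr rfl fun _ _ => by ring

theorem inner_dilVec_dilVec (u u' : Fin n₁ → ℝ) (v v' : Fin n₂ → ℝ) :
    inner ℝ (dilVec u v) (dilVec u' v') = (u ⬝ᵥ u' + v ⬝ᵥ v') / 2 := by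
  have h : (√2)⁻¹ * (√2)⁻¹ = (2 : ℝ)⁻¹ := by rw [← mul_inv, Real.mul_self_sqrt zero_le_two]
  have h1 : (fun i => (dilVec u' v') (Sum.inl i)) = (√2)⁻¹ • u' := rfl
  have h2 : (fun j => (dilVec u' v') (Sum.inr j)) = (√2)⁻¹ • v' := rfl
  rw [inner_dilVec_left, h1, h2, dotProduct_smul, dotProduct_smul, smul_eq_mul, smul_eq_mul,
    ← mul_add, ← mul_assoc, h]
  ring

theorem inner_dilVec_sq_sub_sq (u : Fin n₁ → ℝ) (v : Fin n₂ → ℝ)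
    (x : EuclideanSpace ℝ (Fin n₁ ⊕ Fin n₂)) :
    inner ℝ (dilVec u v) x ^ 2 - inner ℝ (dilVec u (-v)) x ^ 2 =
      2 * ((u ⬝ᵥ (fun i => x (Sum.inl i))) * (v ⬝ᵥ (fun j => x (Sum.inr j)))) := by
  have h : (√2)⁻¹ ^ 2 = (2 : ℝ)⁻¹ := by rw [inv_pow, Real.sq_sqrt zero_le_two]
  rw [inner_dilVec_left, inner_dilVec_left, mul_pow, mul_pow, h, neg_dotProduct]
  ring

theorem sum_mul_inner_dilVec_sq_sub_sq {ι : Type*} [Fintype ι] (s : ι → ℝ) (u : ι → Fin n₁ → ℝ)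
    (v : ι → Fin n₂ → ℝ) (x : EuclideanSpace ℝ (Fin n₁ ⊕ Fin n₂)) :
    ∑ l, s l * (inner ℝ (dilVec (u l) (v l)) x ^ 2 - inner ℝ (dilVec (u l) (-v l)) x ^ 2) =
      2 * ((fun i => x (Sum.inl i)) ⬝ᵥ
        ((∑ i, rank1 (s i) (u i) (v i)) *ᵥ (fun j => x (Sum.inr j)))) := by
  rw [dotProduct_sum_rank1_mulVec, Finset.mul_sum]
  exact Finset.sum_congr rfl fun l _ => by rw [inner_dilVec_sq_sub_sq]; ring

variable {ι : Type*} [DecidableEq ι] {u : ι → Fin n₁ → ℝ} {v : ι → Fin n₂ → ℝ}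

theorem orthonormal_dilVec (hu : ∀ i j, u i ⬝ᵥ u j = if i = j then (1 : ℝ) else 0)
    (hv : ∀ i j, v i ⬝ᵥ v j = if i = j then (1 : ℝ) else 0) :
    Orthonormal ℝ fun i => dilVec (u i) (v i) := by
  rw [orthonormal_iff_ite]
  intro i j
  rw [inner_dilVec_dilVec, hu, hv]
  split_ifs <;> norm_num

theorem inner_dilVec_neg_dilVec (hu : ∀ i j, u i ⬝ᵥ u j = if i = j then (1 : ℝ) else 0)
    (hv : ∀ i j, v i ⬝ᵥ v j = if i = j then (1 : ℝ) else 0) (i j : ι) :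
    inner ℝ (dilVec (u i) (-v i)) (dilVec (u j) (v j)) = 0 := by
  rw [inner_dilVec_dilVec, neg_dotProduct, hu, hv, add_neg_cancel, zero_div]

/-- Mirsky's inequality for the nuclear norm. -/
theorem sum_abs_sub_le_nucNorm_add (hn : n₁ ≤ n₂)
    {σ τ : Fin n₁ → ℝ} {u u' : Fin n₁ → Fin n₁ → ℝ} {v v' : Fin n₁ → Fin n₂ → ℝ}
    (hσ0 : ∀ i, 0 ≤ σ i) (hσ : Antitone σ)
    (hu : ∀ i j, u i ⬝ᵥ u j = if i = j then (1 : ℝ) else 0)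
    (hv : ∀ i j, v i ⬝ᵥ v j = if i = j then (1 : ℝ) else 0)
    (hτ0 : ∀ i, 0 ≤ τ i) (hτ : Antitone τ)
    (hu' : ∀ i j, u' i ⬝ᵥ u' j = if i = j then (1 : ℝ) else 0)
    (hv' : ∀ i j, v' i ⬝ᵥ v' j = if i = j then (1 : ℝ) else 0) :
    ∑ i, |σ i - τ i| ≤
      nucNorm (∑ i, rank1 (σ i) (u i) (v i) + ∑ i, rank1 (τ i) (u' i) (v' i)) := by
  obtain ⟨d, rfl⟩ := Nat.exists_eq_add_of_le hn
  obtain ⟨s, f, q, hs0, hs, hsf, hsq, hM⟩ :=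
    exists_sum_rank1_eq (∑ i, rank1 (σ i) (u i) (v i) + ∑ i, rank1 (τ i) (u' i) (v' i))
  have hnv : ∀ i j, (-v i) ⬝ᵥ (-v j) = if i = j then (1 : ℝ) else 0 := by simpa using hv
  have hnv' : ∀ i j, (-v' i) ⬝ᵥ (-v' j) = if i = j then (1 : ℝ) else 0 := by simpa using hv'
  let R : EuclideanSpace ℝ (Fin n₁ ⊕ Fin (n₁ + d)) →
      EuclideanSpace ℝ (Fin n₁ ⊕ Fin (n₁ + d)) →ₗ[ℝ] EuclideanSpace ℝ (Fin n₁ ⊕ Fin (n₁ + d)) :=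
    fun z => (InnerProductSpace.rankOne ℝ z z).toLinearMap
  let T := ∑ l, σ l • (R (dilVec (u l) (v l)) - R (dilVec (u l) (-v l))) +
    ∑ k, s k • R (dilVec (f k) (-q k))
  have hT : T.IsSymmetric := by
    intro x y
    simp [T, R, sum_inner, inner_sum, inner_add_left, inner_add_right, inner_sub_left,
      inner_sub_right, inner_smul_left, inner_smul_right, real_inner_comm, mul_comm]
  have hTx : ∀ x, inner ℝ (T x) x =
      ∑ l, σ l * (inner ℝ (dilVec (u l) (v l)) x ^ 2 - inner ℝ (dilVec (u l) (-v l)) x ^ 2) +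
        ∑ k, s k * inner ℝ (dilVec (f k) (-q k)) x ^ 2 := fun x => by
    simp [T, R, sum_inner, inner_add_left, inner_sub_left, inner_smul_left, sq]
  have htr : LinearMap.trace ℝ _ T = ∑ k, s k := by
    simp only [T, R, map_add, map_sum, map_smul, map_sub, InnerProductSpace.trace_rankOne,
      inner_dilVec_dilVec, dotProduct_neg, neg_dotProduct, neg_neg, sub_self, smul_eq_mul, mul_zero,
      Finset.sum_const_zero, zero_add]
    exact Finset.sum_congr rfl fun k _ => by linarith [hsf k, hsq k]
  rw [← hs, ← htr]
  refine hT.sum_abs_sub_le_trace (d := d) (by simp) hσ0 hσ (orthonormal_dilVec hu hv)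
    (orthonormal_dilVec hu hnv) (inner_dilVec_neg_dilVec hu hv) (fun x => ?_) hτ0 hτ
    (p' := fun i => dilVec (u' i) (-v' i)) (w' := fun i => dilVec (u' i) (v' i))
    (orthonormal_dilVec hu' hnv') (orthonormal_dilVec hu' hv')
    (fun i j => by rw [real_inner_comm]; exact inner_dilVec_neg_dilVec hu' hv' j i) fun x => ?_
  · rw [hTx]
    exact le_add_of_nonneg_right (Finset.sum_nonneg fun k _ => mul_nonneg (hs0 k) (sq_nonneg _))
  · have h1 := sum_mul_inner_dilVec_sq_sub_sq σ u v x
    have h2 := sum_mul_inner_dilVec_sq_sub_sq τ u' v' x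
    have h3 := sum_mul_inner_dilVec_sq_sub_sq s f q x
    rw [← hM, add_mulVec, dotProduct_add, mul_add, ← h1, ← h2] at h3
    have h4 : 0 ≤ ∑ k, s k * inner ℝ (dilVec (f k) (q k)) x ^ 2 :=
      Finset.sum_nonneg fun k _ => mul_nonneg (hs0 k) (sq_nonneg _)
    rw [hTx]
    simp only [mul_sub, Finset.sum_sub_distrib] at h3 ⊢
    linarith

end Nuclear

theorem stmt3 {n₁ n₂ m k : ℕ} (hn : n₁ ≤ n₂)
    (A : Matrix (Fin n₁) (Fin n₂) ℝ →ₗ[ℝ] EuclideanSpace ℝ (Fin m))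
    (X : Matrix (Fin n₁) (Fin n₂) ℝ)
    (nv : EuclideanSpace ℝ (Fin m)) (ε : ℝ) (hnv : ‖nv‖ ≤ ε)
    (b : EuclideanSpace ℝ (Fin m)) (hb : b = A X + nv)
    (lam : ℝ) (hlam : 0 < lam)
    (Xs : Matrix (Fin n₁) (Fin n₂) ℝ)
    (hXs : ∀ Z : Matrix (Fin n₁) (Fin n₂) ℝ,
      nucNorm Xs + (1 / (2 * lam)) * ‖b - A Xs‖ ^ 2 ≤
        nucNorm Z + (1 / (2 * lam)) * ‖b - A Z‖ ^ 2)
    -- SVD of `X`, with singular values `σX` in decreasing order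
    (σX : Fin n₁ → ℝ) (uX : Fin n₁ → Fin n₁ → ℝ) (vX : Fin n₁ → Fin n₂ → ℝ)
    (hσX0 : ∀ i, 0 ≤ σX i) (hσXmono : ∀ i j : Fin n₁, i ≤ j → σX j ≤ σX i)
    (huX : ∀ i j, ∑ a, uX i a * uX j a = if i = j then (1 : ℝ) else 0)
    (hvX : ∀ i j, ∑ b, vX i b * vX j b = if i = j then (1 : ℝ) else 0)
    (hX : X = ∑ i, rank1 (σX i) (uX i) (vX i))
    -- SVD of `H = Xs - X`, with singular values `σH` in decreasing order
    (σH : Fin n₁ → ℝ) (uH : Fin n₁ → Fin n₁ → ℝ) (vH : Fin n₁ → Fin n₂ → ℝ)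
    (hσH0 : ∀ i, 0 ≤ σH i) (hσHmono : ∀ i j : Fin n₁, i ≤ j → σH j ≤ σH i)
    (huH : ∀ i j, ∑ a, uH i a * uH j a = if i = j then (1 : ℝ) else 0)
    (hvH : ∀ i j, ∑ b, vH i b * vH j b = if i = j then (1 : ℝ) else 0)
    (hH : Xs - X = ∑ i, rank1 (σH i) (uH i) (vH i))
    (E : Finset (Fin n₁)) (hE : E.card = k) :
    ‖A (Xs - X)‖ ^ 2 - 2 * ε * ‖A (Xs - X)‖ ≤
      2 * lam * ((∑ i ∈ E, σH i) - (∑ i ∈ Eᶜ, σH i) + 2 * (∑ i ∈ Eᶜ, σX i)) := by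
  have hb2 : ∀ H : EuclideanSpace ℝ (Fin m), ‖nv - H‖ ^ 2 = ‖nv‖ ^ 2 - 2 * inner ℝ nv H + ‖H‖ ^ 2 :=
    norm_sub_sq_real nv
  have hmin := hXs X
  have hXX : b - A X = nv := by rw [hb]; abel
  have hXXs : b - A Xs = nv - A (Xs - X) := by rw [hb, map_sub]; abel
  have hnX : nucNorm X = ∑ i, σX i := hX ▸ nucNorm_sum_rank1 hσX0 huX hvX
  have hmirsky : ∑ i, |σX i - σH i| ≤ nucNorm Xs := by
    have h := sum_abs_sub_le_nucNorm_add hn hσX0 (fun i j h => hσXmono i j h) huX hvX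
      hσH0 (fun i j h => hσHmono i j h) huH hvH
    rwa [← hX, ← hH, add_sub_cancel] at h
  rw [hXX, hXXs, hb2, hnX] at hmin
  have hcs : inner ℝ nv (A (Xs - X)) ≤ ε * ‖A (Xs - X)‖ :=
    (real_inner_le_norm _ _).trans (mul_le_mul_of_nonneg_right hnv (norm_nonneg _))
  have hE1 : ∑ i ∈ E, (σX i - σH i) ≤ ∑ i ∈ E, |σX i - σH i| :=
    Finset.sum_le_sum fun i _ => le_abs_self _
  have hE2 : ∑ i ∈ Eᶜ, (σH i - σX i) ≤ ∑ i ∈ Eᶜ, |σX i - σH i| :=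
    Finset.sum_le_sum fun i _ => by rw [abs_sub_comm]; exact le_abs_self _
  rw [← Finset.sum_add_sum_compl E] at hmirsky
  rw [← Finset.sum_add_sum_compl E σX] at hmin
  rw [Finset.sum_sub_distrib] at hE1 hE2
  set D := ‖A (Xs - X)‖ ^ 2 - 2 * inner ℝ nv (A (Xs - X)) with hD
  have hkey : D / (2 * lam) ≤
      (∑ i ∈ E, σH i) - (∑ i ∈ Eᶜ, σH i) + 2 * (∑ i ∈ Eᶜ, σX i) := by
    have : D / (2 * lam) = 1 / (2 * lam) * (‖nv‖ ^ 2 - 2 * inner ℝ nv (A (Xs - X)) +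
        ‖A (Xs - X)‖ ^ 2) - 1 / (2 * lam) * ‖nv‖ ^ 2 := by rw [hD]; ring
    linarith
  rw [div_le_iff₀ (by positivity)] at hkey
  linarith
end
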